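/- arXiv:0711.2489 — 6 statements merged into one kernel-verified Lean document; each statement's English description precedes it below -/
import Mathlib

section
/- Let ≽ be a binary relation on ℝ^n, n ≥ 2. The following are equivalent: (1) ≽ satisfies A1, A2, A3, A4, A5, A6, A7 and A8; (2) there is a unique symmetric capacity μ on X = {1,…,n}, at most 2-additive and whose weight vector is strictly decreasing (w_1 > w_2 > ⋯ > w_n), such that ≽ is represented by C_μ; (3) there is a unique symmetric capacity μ on X whose Möbius transform m satisfies m(A) = 0 for |A| > 2, m(A) ≥ 0 for all A, and m(A) > 0 for |A| = 2 (a 2-additive symmetric belief function), such that ≽ is represented by C_μ. -/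
open Finset

/-- A capacity on `X = {1,…,n}` (modelled as `Fin n`). -/
def IsCapacity {n : ℕ} (μ : Finset (Fin n) → ℝ) : Prop :=
  μ ∅ = 0 ∧ μ Finset.univ = 1 ∧ ∀ A B : Finset (Fin n), A ⊆ B → μ A ≤ μ B

/-- A symmetric capacity: the value depends only on the cardinality. -/
def IsSymmetricCap {n : ℕ} (μ : Finset (Fin n) → ℝ) : Prop :=
  ∀ A B : Finset (Fin n), A.card = B.card → μ A = μ B

/-- The Möbius transform of a set function. -/
noncomputable def mobius {n : ℕ} (μ : Finset (Fin n) → ℝ) (A : Finset (Fin n)) : ℝ :=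
  ∑ B ∈ A.powerset, (-1 : ℝ) ^ (A.card - B.card) * μ B

/-- `μ` is at most `k`-additive: its Möbius transform vanishes on sets of more than `k` elements. -/
def AtMostAdditive {n : ℕ} (k : ℕ) (μ : Finset (Fin n) → ℝ) : Prop :=
  ∀ A : Finset (Fin n), k < A.card → mobius μ A = 0

/-- The Choquet integral of the act `f` with respect to `μ`:
`C_μ(f) = Σ_i (f_(i) - f_(i-1)) μ(B_i)` with `f_(0) = 0`, where the increasing rearrangement
is obtained through the sorting permutation `Tuple.sort f`, and `B_i = {σ(i),…,σ(n)}`. -/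
noncomputable def choquet {n : ℕ} (μ : Finset (Fin n) → ℝ) (f : Fin n → ℝ) : ℝ :=
  ∑ i : Fin n,
    (f (Tuple.sort f i) -
      if (i : ℕ) = 0 then 0
      else f (Tuple.sort f ⟨(i : ℕ) - 1, lt_of_le_of_lt (Nat.sub_le _ _) i.isLt⟩)) *
    μ ((Finset.univ.filter fun j : Fin n => i ≤ j).image (Tuple.sort f))

/-- The OWA operator with weights `w`: `Σ_i w_i f_(i)`. -/
noncomputable def owa {n : ℕ} (w f : Fin n → ℝ) : ℝ :=
  ∑ i : Fin n, w i * f (Tuple.sort f i)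

/-- `w` is the weight vector of the symmetric capacity `μ`:
`μ(T) = Σ_{i = n - |T| + 1}^{n} w_i` (1-based), i.e. the sum of the last `|T|` weights. -/
def IsWeightOf {n : ℕ} (w : Fin n → ℝ) (μ : Finset (Fin n) → ℝ) : Prop :=
  ∀ T : Finset (Fin n), T.Nonempty →
    μ T = ∑ i ∈ Finset.univ.filter (fun i : Fin n => n - T.card ≤ (i : ℕ)), w i

/-- `w` viewed with natural-number (0-based) indices, junk value `0` out of range
(never used in the statements below). -/
noncomputable def wAt {n : ℕ} (w : Fin n → ℝ) (i : ℕ) : ℝ :=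
  if h : i < n then w ⟨i, h⟩ else 0

/-- The alternating sum `Σ_{j=0}^{k-1} (-1)^j C(k-1,j) w_{i+j}`, with `i` a 1-based index. -/
noncomputable def altSum {n : ℕ} (w : Fin n → ℝ) (k i : ℕ) : ℝ :=
  ∑ j ∈ Finset.range k, (-1 : ℝ) ^ j * ((k - 1).choose j : ℝ) * wAt w (i - 1 + j)

/-- A preference relation on acts. -/
abbrev Pref (n : ℕ) := (Fin n → ℝ) → (Fin n → ℝ) → Prop

/-- Asymmetric (strict) part of a preference relation. -/
def StrictP {n : ℕ} (R : Pref n) (f g : Fin n → ℝ) : Prop := R f g ∧ ¬ R g f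

/-- Symmetric (indifference) part of a preference relation. -/
def IndiffP {n : ℕ} (R : Pref n) (f g : Fin n → ℝ) : Prop := R f g ∧ R g f

/-- `V` represents `≽`: `f ≽ g ↔ V f ≥ V g`. -/
def Represents {n : ℕ} (V : (Fin n → ℝ) → ℝ) (R : Pref n) : Prop :=
  ∀ f g, R f g ↔ V g ≤ V f

/-- A1: weak order (complete, reflexive, transitive). -/
def AxA1 {n : ℕ} (R : Pref n) : Prop :=
  (∀ f g, R f g ∨ R g f) ∧ (∀ f, R f f) ∧ (∀ f g h, R f g → R g h → R f h)

/-- A2: continuity, the strict upper and lower contour sets are open. -/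
def AxA2 {n : ℕ} (R : Pref n) : Prop :=
  ∀ f, IsOpen {g | StrictP R g f} ∧ IsOpen {g | StrictP R f g}

/-- A3: symmetry under permutations. -/
def AxA3 {n : ℕ} (R : Pref n) : Prop :=
  ∀ (f : Fin n → ℝ) (π : Equiv.Perm (Fin n)), IndiffP R f (f ∘ π)

/-- A4: weak independence of income source (on nondecreasing acts). -/
def AxA4 {n : ℕ} (R : Pref n) : Prop :=
  ∀ f g h : Fin n → ℝ, Monotone f → Monotone g → Monotone h →
    (R f g ↔ R (f + h) (g + h))

/-- A5: monotonicity. -/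
def AxA5 {n : ℕ} (R : Pref n) : Prop :=
  ∀ f g : Fin n → ℝ, (∀ i, g i ≤ f i) → R f g

/-- A6: non-triviality. -/
def AxA6 {n : ℕ} (R : Pref n) : Prop :=
  ∃ f g, StrictP R f g

/-- `i` `f`-precedes `j` : `f i < f j` and no value of `f` lies strictly between them. -/
def Precedes {n : ℕ} (f : Fin n → ℝ) (i j : Fin n) : Prop :=
  f i < f j ∧ ∀ l, ¬ (f i < f l ∧ f l < f j)

/-- A7: order-preserving transfer. -/
def AxA7 {n : ℕ} (R : Pref n) : Prop :=
  ∀ (f f' g g' : Fin n → ℝ) (i j : Fin n) (t : ℝ), 0 < t →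
    Precedes f i j → Precedes g i j → Precedes f' i j → Precedes g' i j →
    f' i = f i + t → g' i = g i + t → f' j = f j - t → g' j = g j - t →
    (∀ l, l ≠ i → l ≠ j → f' l = f l) → (∀ l, l ≠ i → l ≠ j → g' l = g l) →
    (R f g ↔ R f' g')

/-- A8: inequality aversion. -/
def AxA8 {n : ℕ} (R : Pref n) : Prop :=
  ∀ (f f' : Fin n → ℝ), Monotone f → Monotone f' →
    ∀ (i : Fin n) (hi : (i : ℕ) + 1 < n) (t : ℝ), 0 < t →
      f' i = f i + t → f' ⟨(i : ℕ) + 1, hi⟩ = f ⟨(i : ℕ) + 1, hi⟩ - t →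
      (∀ j, j ≠ i → j ≠ (⟨(i : ℕ) + 1, hi⟩ : Fin n) → f' j = f j) →
      StrictP R f' f

/-- Comonotone acts. -/
def Comonotone {n : ℕ} (f g : Fin n → ℝ) : Prop :=
  ∀ i j, 0 ≤ (f i - f j) * (g i - g j)

/-- The chain condition: (0-based) index `i` `f`-precedes `i+1`, which `f`-precedes `i+2`, …,
which `f`-precedes `i+k`. -/
def PrecChain {n : ℕ} (f : Fin n → ℝ) (i k : ℕ) (h : i + k < n) : Prop :=
  ∀ r, ∀ _hr : r < k, Precedes f ⟨i + r, by omega⟩ ⟨i + r + 1, by omega⟩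

/-- A7(k): k-dimensional order-preserving transfer. -/
def AxA7k {n : ℕ} (k : ℕ) (R : Pref n) : Prop :=
  ∀ (f g f' g' : Fin n → ℝ) (i : ℕ) (hik : i + k < n) (t : ℝ), 0 < t →
    PrecChain f i k hik → PrecChain g i k hik →
    PrecChain f' i k hik → PrecChain g' i k hik →
    (∀ j, ∀ _hj : j < k, f' ⟨i + j, by omega⟩ =
      f ⟨i + j, by omega⟩ + (-1 : ℝ) ^ j * ((k - 1).choose j : ℝ) * t) →
    (∀ j, ∀ _hj : j < k, g' ⟨i + j, by omega⟩ =
      g ⟨i + j, by omega⟩ + (-1 : ℝ) ^ j * ((k - 1).choose j : ℝ) * t) →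
    (∀ l : Fin n, ((l : ℕ) < i ∨ i + k ≤ (l : ℕ)) → f' l = f l) →
    (∀ l : Fin n, ((l : ℕ) < i ∨ i + k ≤ (l : ℕ)) → g' l = g l) →
    Comonotone f f' → Comonotone g g' →
    (R f g ↔ R f' g')

/-- The act `f^B`: add `t` to the coordinates in `B`, keep the others. -/
def shiftAct {n : ℕ} (f : Fin n → ℝ) (t : ℝ) (B : Finset (Fin n)) : Fin n → ℝ :=
  fun l => if l ∈ B then f l + t else f l

/-- A9: asymmetric order-preserving transfer (2-dimensional). -/
def AxA9 {n : ℕ} (R : Pref n) : Prop :=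
  ∃ H : (Fin n → ℝ) → ℝ, Represents H R ∧
    ∀ i j : Fin n, i ≠ j → ∀ f g : Fin n → ℝ, f i = f j → g i = g j →
      ∀ t : ℝ, 0 < t →
      (∀ B ∈ ({i, j} : Finset (Fin n)).powerset, Comonotone f (shiftAct f t B)) →
      (∀ B ∈ ({i, j} : Finset (Fin n)).powerset, Comonotone g (shiftAct g t B)) →
      ∑ B ∈ ({i, j} : Finset (Fin n)).powerset, (-1 : ℝ) ^ B.card * H (shiftAct f t B) =
        ∑ B ∈ ({i, j} : Finset (Fin n)).powerset, (-1 : ℝ) ^ B.card * H (shiftAct g t B)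

/-- A9(k): k-dimensional asymmetric order-preserving transfer. -/
def AxA9k {n : ℕ} (k : ℕ) (R : Pref n) : Prop :=
  ∃ H : (Fin n → ℝ) → ℝ, Represents H R ∧
    ∀ S : Finset (Fin n), S.card = k →
      ∀ f g : Fin n → ℝ, (∀ i ∈ S, ∀ j ∈ S, f i = f j) → (∀ i ∈ S, ∀ j ∈ S, g i = g j) →
        ∀ t : ℝ, 0 < t →
        (∀ B ∈ S.powerset, Comonotone f (shiftAct f t B)) →
        (∀ B ∈ S.powerset, Comonotone g (shiftAct g t B)) →
        ∑ B ∈ S.powerset, (-1 : ℝ) ^ B.card * H (shiftAct f t B) =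
          ∑ B ∈ S.powerset, (-1 : ℝ) ^ B.card * H (shiftAct g t B)


/-- Summation by parts for the increments of `g`. -/
lemma sum_range_increment_mul (g Q : ℕ → ℝ) (m : ℕ) :
    ∑ i ∈ range m, (g i - if i = 0 then 0 else g (i - 1)) * Q i =
      ∑ i ∈ range m, g i * (Q i - Q (i + 1)) + (if m = 0 then 0 else g (m - 1)) * Q m := by
  induction m with
  | zero => simp
  | succ m ih =>
    rw [sum_range_succ, sum_range_succ, ih]
    simp only [Nat.add_eq_zero_iff, one_ne_zero, and_false, if_false, Nat.add_sub_cancel]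
    ring

lemma sum_fin_increment_mul {n : ℕ} (g : Fin n → ℝ) (Q : ℕ → ℝ) (hQ : Q n = 0) :
    ∑ i : Fin n, (g i - if (i : ℕ) = 0 then 0
      else g ⟨(i : ℕ) - 1, lt_of_le_of_lt (Nat.sub_le _ _) i.isLt⟩) * Q i =
      ∑ i : Fin n, g i * (Q i - Q (i + 1)) := by
  have h := sum_range_increment_mul (fun k => if h : k < n then g ⟨k, h⟩ else 0) Q n
  rw [hQ, mul_zero, add_zero, ← Fin.sum_univ_eq_sum_range
    (fun i => ((if h : i < n then g ⟨i, h⟩ else 0) - if i = 0 then 0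
      else if h : i - 1 < n then g ⟨i - 1, h⟩ else 0) * Q i),
    ← Fin.sum_univ_eq_sum_range
    (fun i => (if h : i < n then g ⟨i, h⟩ else 0) * (Q i - Q (i + 1)))] at h
  convert h using 3 with i _ i
  · have : (i : ℕ) - 1 < n := lt_of_le_of_lt (Nat.sub_le _ _) i.isLt
    simp [this]
  · simp

lemma card_image_perm_Ici {n : ℕ} (σ : Equiv.Perm (Fin n)) (i : Fin n) :
    ((univ.filter fun j : Fin n => i ≤ j).image σ).card = n - i := by
  rw [card_image_of_injective _ σ.injective, filter_le_eq_Ici, Fin.card_Ici]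

/-- The Choquet integral of a symmetric capacity is an ordered weighted average. -/
lemma choquet_eq_sum {n : ℕ} {μ : Finset (Fin n) → ℝ} {p : ℕ → ℝ}
    (hμ : ∀ A, μ A = p A.card) (h0 : p 0 = 0) (f : Fin n → ℝ) :
    choquet μ f = ∑ i : Fin n, f (Tuple.sort f i) * (p (n - i) - p (n - (i + 1))) := by
  have h := sum_fin_increment_mul (fun i => f (Tuple.sort f i)) (fun k => p (n - k))
    (by simpa using h0)
  rw [← h]
  simp only [choquet, hμ, card_image_perm_Ici]

lemma comp_sort_of_monotone {n : ℕ} {f : Fin n → ℝ} (hf : Monotone f) (i : Fin n) :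
    f (Tuple.sort f i) = f i := by
  rw [Tuple.sort_eq_refl_iff_monotone.2 hf]; rfl

/-- The value at a set of size `k` of a symmetric `2`-additive set function with
Möbius transform `a` on singletons and `b` on pairs. -/
noncomputable def quadCap (a b : ℝ) (k : ℕ) : ℝ := a * k + b * (k * (k - 1) / 2)

lemma quadCap_zero (a b : ℝ) : quadCap a b 0 = 0 := by simp [quadCap]

/-- The sum of all coordinates weighted by `a`, plus the sum of the minima over pairs
weighted by `b`. -/
noncomputable def pairMin {n : ℕ} (a b : ℝ) (f : Fin n → ℝ) : ℝ :=
  a * ∑ i, f i + b / 2 * ∑ i, ∑ j, if i = j then 0 else min (f i) (f j)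

lemma pairMin_perm {n : ℕ} (a b : ℝ) (f : Fin n → ℝ) (π : Equiv.Perm (Fin n)) :
    pairMin a b (f ∘ π) = pairMin a b f := by
  have h1 : ∑ i, f (π i) = ∑ i, f i := Equiv.sum_comp π f
  have h2 : ∑ i, ∑ j, (if i = j then 0 else min (f (π i)) (f (π j))) =
      ∑ i, ∑ j, if i = j then 0 else min (f i) (f j) := by
    rw [← Equiv.sum_comp π (fun i => ∑ j, if i = j then 0 else min (f i) (f j))]
    refine sum_congr rfl fun i _ => ?_
    rw [← Equiv.sum_comp π (fun j => if π i = j then 0 else min (f (π i)) (f j))]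
    simp
  simp only [pairMin, Function.comp, h1, h2]

lemma pairMin_of_monotone {n : ℕ} (a b : ℝ) {f : Fin n → ℝ} (hf : Monotone f) :
    pairMin a b f = ∑ i : Fin n, f i * (a + b * ((n : ℝ) - 1 - (i : ℕ))) := by
  have key : ∑ i, ∑ j, (if i = j then 0 else min (f i) (f j)) =
      2 * ∑ i : Fin n, f i * ((n : ℝ) - 1 - (i : ℕ)) := by
    have h1 : ∀ i j : Fin n, (if i = j then 0 else min (f i) (f j)) =
        (if i < j then f i else 0) + (if j < i then f j else 0) := by
      intro i j
      rcases lt_trichotomy i j with h | h | h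
      · simp [h, h.ne, h.not_gt, hf h.le]
      · simp [h]
      · simp [h, h.ne', h.not_gt, hf h.le]
    have h2 : ∑ i : Fin n, ∑ j : Fin n, (if i < j then f i else 0) =
        ∑ i : Fin n, f i * ((n : ℝ) - 1 - (i : ℕ)) := by
      refine sum_congr rfl fun i _ => ?_
      rw [← sum_filter, sum_const, filter_lt_eq_Ioi, Fin.card_Ioi, nsmul_eq_mul, mul_comm]
      have := i.isLt
      rw [Nat.sub_sub, Nat.cast_sub (by omega)]
      push_cast; ring
    simp only [h1, sum_add_distrib]
    rw [h2, sum_comm (f := fun i j : Fin n => if j < i then f j else 0), h2]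
    ring
  rw [pairMin, key]
  simp only [mul_add, sum_add_distrib]
  rw [mul_sum, mul_sum, mul_sum]
  congr 1 <;> refine sum_congr rfl fun i _ => ?_ <;> ring

lemma quadCap_sub (a b : ℝ) {n i : ℕ} (hi : i < n) :
    quadCap a b (n - i) - quadCap a b (n - (i + 1)) = a + b * ((n : ℝ) - 1 - i) := by
  obtain ⟨k, rfl⟩ := Nat.exists_eq_add_of_lt hi
  rw [show i + k + 1 - i = k + 1 by omega, show i + k + 1 - (i + 1) = k by omega]
  simp only [quadCap]
  push_cast; ring

lemma choquet_eq_pairMin {n : ℕ} {μ : Finset (Fin n) → ℝ} {a b : ℝ}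
    (hμ : ∀ A, μ A = quadCap a b A.card) (f : Fin n → ℝ) :
    choquet μ f = pairMin a b f := by
  rw [choquet_eq_sum hμ (quadCap_zero a b), ← pairMin_perm a b f (Tuple.sort f),
    pairMin_of_monotone a b (Tuple.monotone_sort f)]
  exact sum_congr rfl fun i _ => by rw [quadCap_sub a b i.isLt]; rfl

lemma pairMin_const {n : ℕ} (a b c : ℝ) :
    pairMin a b (fun _ : Fin n => c) = quadCap a b n * c := by
  have h : ∀ i : Fin n, ∑ j : Fin n, (if i = j then 0 else c) = (n - 1) * c := by
    intro i
    have : ∀ j : Fin n, (if i = j then 0 else c) = c - if i = j then c else 0 := by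
      intro j; split_ifs <;> simp
    simp only [this, sum_sub_distrib, sum_ite_eq, mem_univ, if_true, sum_const, card_univ,
      Fintype.card_fin, nsmul_eq_mul]
    ring
  simp only [pairMin, min_self, h, sum_const, card_univ, Fintype.card_fin, nsmul_eq_mul, quadCap]
  ring

lemma pairMin_single {n : ℕ} (a b : ℝ) (x : Fin n) :
    pairMin a b (Pi.single x 1) = a := by
  have h : ∀ i j : Fin n, (if i = j then 0 else
      min ((Pi.single x 1 : Fin n → ℝ) i) ((Pi.single x 1 : Fin n → ℝ) j)) = 0 := by
    intro i j
    by_cases hij : i = j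
    · simp [hij]
    · by_cases hi : i = x
      · subst hi; simp [hij, Ne.symm hij]
      · by_cases hj : j = x <;> simp [hij, hi, hj]
  simp [pairMin, h]

lemma pairMin_mono {n : ℕ} {a b : ℝ} (ha : 0 ≤ a) (hb : 0 ≤ b) {f g : Fin n → ℝ}
    (h : ∀ i, g i ≤ f i) : pairMin a b g ≤ pairMin a b f := by
  unfold pairMin
  gcongr with i _ i _ j
  · exact h i
  · split_ifs
    · exact le_rfl
    · exact min_le_min (h i) (h j)

lemma continuous_pairMin {n : ℕ} (a b : ℝ) : Continuous (pairMin (n := n) a b) := by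
  unfold pairMin
  refine (continuous_const.mul (by fun_prop)).add (continuous_const.mul ?_)
  refine continuous_finsetSum _ fun i _ => continuous_finsetSum _ fun j _ => ?_
  split_ifs
  · exact continuous_const
  · fun_prop

/-- An order-preserving transfer of `t` from `j` to `i` raises `pairMin a b` by `b * t`. -/
lemma pairMin_transfer {n : ℕ} (a b : ℝ) {f f' : Fin n → ℝ} {i j : Fin n} {t : ℝ} (ht : 0 < t)
    (hij : f' i ≤ f' j) (hbetween : ∀ l, ¬ (f i < f l ∧ f l < f j))
    (hi : f' i = f i + t) (hj : f' j = f j - t) (hl : ∀ l, l ≠ i → l ≠ j → f' l = f l) :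
    pairMin a b f' = pairMin a b f + b * t := by
  have hne : i ≠ j := by rintro rfl; linarith
  have hlt : f i + t ≤ f j - t := by linarith
  let u : Fin n → ℝ := fun x => (if x = i then 1 else 0) - (if x = j then 1 else 0)
  let U : Fin n → ℝ := fun x => if f j ≤ f x then 1 else 0
  have hf' : ∀ x, f' x = f x + t * u x := by
    intro x
    by_cases hxi : x = i
    · subst hxi; simp [u, hi, hne]
    · by_cases hxj : x = j
      · subst hxj; simp [u, hj, hxi]; ring
      · simp [u, hxi, hxj, hl x hxi hxj]
  have hu : ∑ x, u x = 0 := by simp [u, sum_sub_distrib]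
  have hD : ∀ x y, (if x = y then 0 else min (f' x) (f' y)) =
      (if x = y then 0 else min (f x) (f y)) + t * (u x * U y + U x * u y) +
        if x = y then (if x = j then 2 * t else 0) else 0 := by
    intro x y
    have hUi : U i = 0 := by simp only [U]; rw [if_neg]; linarith
    have hUj : U j = 1 := by simp [U]
    have hui : u i = 1 := by simp [u, hne]
    have huj : u j = -1 := by simp [u, hne.symm]
    have huo : ∀ z, z ≠ i → z ≠ j → u z = 0 := by intro z h1 h2; simp [u, h1, h2]
    have hio : ∀ z, z ≠ i → z ≠ j → min (f i + t) (f z) = min (f i) (f z) + t * U z := by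
      intro z _ _
      by_cases hz : f j ≤ f z
      · simp only [U, if_pos hz]
        rw [min_eq_left (by linarith), min_eq_left (by linarith)]; ring
      · have : f z ≤ f i := by
          by_contra h; exact hbetween z ⟨not_le.1 h, not_le.1 hz⟩
        simp only [U, if_neg hz]
        rw [min_eq_right (by linarith), min_eq_right (by linarith)]; ring
    have hjo : ∀ z, z ≠ i → z ≠ j → min (f j - t) (f z) = min (f j) (f z) - t * U z := by
      intro z _ _
      by_cases hz : f j ≤ f z
      · simp only [U, if_pos hz]
        rw [min_eq_left (by linarith), min_eq_left (by linarith)]; ring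
      · have : f z ≤ f i := by
          by_contra h; exact hbetween z ⟨not_le.1 h, not_le.1 hz⟩
        simp only [U, if_neg hz]
        rw [min_eq_right (by linarith), min_eq_right (by linarith)]; ring
    by_cases hxy : x = y
    · subst hxy
      by_cases hxi : x = i
      · subst hxi; simp [hUi, hne]
      · by_cases hxj : x = j
        · subst hxj; simp [hUj, huj]; ring
        · simp [hxj, huo x hxi hxj]
    · simp only [if_neg hxy]
      by_cases hxi : x = i
      · subst hxi
        by_cases hyj : y = j
        · subst hyj
          rw [hi, hj, min_eq_left hlt, min_eq_left (by linarith), hUi, hUj, hui, huj]; ring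
        · rw [hi, hl y (Ne.symm hxy) hyj, hio y (Ne.symm hxy) hyj, hUi, hui,
            huo y (Ne.symm hxy) hyj]; ring
      · by_cases hxj : x = j
        · subst hxj
          by_cases hyi : y = i
          · subst hyi
            rw [hi, hj, min_eq_right hlt, min_eq_right (by linarith), hUi, hUj, hui, huj]; ring
          · rw [hj, hl y hyi (Ne.symm hxy), hjo y hyi (Ne.symm hxy), hUj, huj,
              huo y hyi (Ne.symm hxy)]; ring
        · rw [hl x hxi hxj, huo x hxi hxj]
          by_cases hyi : y = i
          · subst hyi
            rw [hi, min_comm, hio x hxi hxj, hui, min_comm]; ring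
          · by_cases hyj : y = j
            · subst hyj
              rw [hj, min_comm, hjo x hxi hxj, huj, min_comm]; ring
            · rw [hl y hyi hyj, huo y hyi hyj]; ring
  have hsum : ∑ x, ∑ y, (if x = y then 0 else min (f' x) (f' y)) =
      ∑ x, ∑ y, (if x = y then 0 else min (f x) (f y)) + 2 * t := by
    simp only [hD, sum_add_distrib, ← mul_sum, ← sum_mul, hu]
    simp
  have hs : ∑ x, f' x = ∑ x, f x := by
    simp only [hf', sum_add_distrib, ← mul_sum, hu]; ring
  rw [pairMin, pairMin, hsum, hs]; ring

lemma mobius_eq_fwdDiff {n : ℕ} {μ : Finset (Fin n) → ℝ} {p : ℕ → ℝ}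
    (hμ : ∀ A, μ A = p A.card) (A : Finset (Fin n)) :
    mobius μ A = (fwdDiff 1)^[A.card] p 0 := by
  rw [fwdDiff_iter_eq_sum_shift]
  simp only [mobius, hμ]
  rw [sum_powerset_apply_card (fun k => (-1 : ℝ) ^ (A.card - k) * p k)]
  refine sum_congr rfl fun k _ => ?_
  simp only [nsmul_eq_mul, zsmul_eq_mul, zero_add, smul_eq_mul, mul_one]
  push_cast; ring

lemma fwdDiff_iter_quadCap (a b : ℝ) (k : ℕ) :
    (fwdDiff 1)^[k] (quadCap a b) 0 = if k = 1 then a else if k = 2 then b else 0 := by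
  have h1 : fwdDiff 1 (quadCap a b) = fun k : ℕ => a + b * k := by
    funext k; simp only [fwdDiff, quadCap]; push_cast; ring
  have h2 : fwdDiff 1 (fun k : ℕ => a + b * (k : ℝ)) = fun _ => b := by
    funext k; simp only [fwdDiff]; push_cast; ring
  have h3 : fwdDiff 1 (fun _ : ℕ => b) = fun _ => 0 := by
    funext k; simp [fwdDiff]
  have h4 : ∀ m, (fwdDiff 1)^[m] (fun _ : ℕ => (0 : ℝ)) = fun _ => 0 := by
    intro m
    induction m with
    | zero => rfl
    | succ m ih =>
      rw [Function.iterate_succ_apply, show fwdDiff 1 (fun _ : ℕ => (0 : ℝ)) = fun _ => 0 by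
        funext k; simp [fwdDiff], ih]
  match k with
  | 0 => simp [quadCap]
  | 1 => simp [h1]
  | 2 => simp [h1, h2]
  | m + 3 =>
    rw [Function.iterate_succ_apply, Function.iterate_succ_apply, Function.iterate_succ_apply,
      h1, h2, h3, h4]
    simp

lemma mobius_quadCap {n : ℕ} {μ : Finset (Fin n) → ℝ} {a b : ℝ}
    (hμ : ∀ A, μ A = quadCap a b A.card) (A : Finset (Fin n)) :
    mobius μ A = if A.card = 1 then a else if A.card = 2 then b else 0 := by
  rw [mobius_eq_fwdDiff hμ, fwdDiff_iter_quadCap]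

lemma exists_finset_card {n k : ℕ} (hk : k ≤ n) : ∃ A : Finset (Fin n), A.card = k := by
  obtain ⟨A, -, hA⟩ := exists_subset_card_eq (s := (univ : Finset (Fin n))) (n := k) (by simpa)
  exact ⟨A, hA⟩

lemma IsSymmetricCap.exists_card {n : ℕ} {μ : Finset (Fin n) → ℝ} (h : IsSymmetricCap μ) :
    ∃ p : ℕ → ℝ, ∀ A, μ A = p A.card := by
  refine ⟨fun k => μ (univ.filter fun i : Fin n => (i : ℕ) < k), fun A => h _ _ ?_⟩
  rw [Fin.card_filter_val_lt, min_eq_right]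
  simpa using card_le_univ A

lemma exists_quadCap_of_atMostAdditive {n : ℕ} {μ : Finset (Fin n) → ℝ} (h0 : μ ∅ = 0)
    (hs : IsSymmetricCap μ) (h2 : AtMostAdditive 2 μ) :
    ∃ a b : ℝ, ∀ A, μ A = quadCap a b A.card := by
  obtain ⟨p, hp⟩ := hs.exists_card
  have hp0 : p 0 = 0 := by rw [← h0, hp, card_empty]
  refine ⟨(fwdDiff 1)^[1] p 0, (fwdDiff 1)^[2] p 0, fun A => ?_⟩
  rw [hp]
  have hA : A.card ≤ n := by simpa using card_le_univ A
  have h := shift_eq_sum_fwdDiff_iter 1 p A.card 0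
  rw [zero_add, smul_eq_mul, mul_one] at h
  have hz : ∀ k ∈ range (A.card + 1), A.card.choose k • (fwdDiff 1)^[k] p 0 =
      (if k = 1 then (A.card : ℝ) * (fwdDiff 1)^[1] p 0 else 0) +
      (if k = 2 then (A.card : ℝ) * (A.card - 1) / 2 * (fwdDiff 1)^[2] p 0 else 0) := by
    intro k hk
    match k with
    | 0 => simp [hp0]
    | 1 => simp
    | 2 => simp [Nat.cast_choose_two]
    | m + 3 =>
      obtain ⟨B, hB⟩ := exists_finset_card (n := n) (k := m + 3)
        (by have := mem_range.1 hk; omega)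
      rw [← hB, ← mobius_eq_fwdDiff hp B, h2 B (by omega)]
      simp [hB]
  rw [h, sum_congr rfl hz, sum_add_distrib, sum_ite_eq', sum_ite_eq', quadCap]
  rcases hc : A.card with _ | _ | m
  · simp
  · simp
  · rw [if_pos (by simp), if_pos (by simp)]; ring

/-- `μ` is a symmetric capacity with constant Möbius values `a ≥ 0` on singletons and `b > 0`
on pairs, and no other nonzero Möbius value. -/
def IsQuadCap {n : ℕ} (a b : ℝ) (μ : Finset (Fin n) → ℝ) : Prop :=
  0 ≤ a ∧ 0 < b ∧ quadCap a b n = 1 ∧ ∀ A, μ A = quadCap a b A.card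

lemma quadCap_mono {a b : ℝ} (ha : 0 ≤ a) (hb : 0 ≤ b) : Monotone (quadCap a b) := by
  refine monotone_nat_of_le_succ fun k => ?_
  have : 0 ≤ b * (k : ℝ) := by positivity
  simp only [quadCap]; push_cast; linarith

namespace IsQuadCap

variable {n : ℕ} {a b : ℝ} {μ : Finset (Fin n) → ℝ}

lemma isCapacity (h : IsQuadCap a b μ) : IsCapacity μ := by
  obtain ⟨ha, hb, h1, hμ⟩ := h
  refine ⟨by simp [hμ, quadCap], by simp [hμ, h1], fun A B hAB => ?_⟩
  rw [hμ, hμ]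
  exact quadCap_mono ha hb.le (card_le_card hAB)

lemma isSymmetricCap (h : IsQuadCap a b μ) : IsSymmetricCap μ := fun A B hAB => by
  rw [h.2.2.2, h.2.2.2, hAB]

lemma atMostAdditive (h : IsQuadCap a b μ) : AtMostAdditive 2 μ := fun A hA => by
  rw [mobius_quadCap h.2.2.2, if_neg (by omega), if_neg (by omega)]

lemma of_quadCap (hn : 2 ≤ n) (hc : IsCapacity μ) (hμ : ∀ A, μ A = quadCap a b A.card)
    (hb : 0 < b) : IsQuadCap a b μ := by
  refine ⟨?_, hb, ?_, hμ⟩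
  · obtain ⟨A, hA⟩ := exists_finset_card (n := n) (k := 1) (by omega)
    have := hc.2.2 ∅ A (empty_subset _)
    rw [hc.1, hμ, hA] at this
    simpa [quadCap] using this
  · have := hc.2.1
    rwa [hμ, card_univ, Fintype.card_fin] at this

lemma exists_iff_belief (hn : 2 ≤ n) :
    (∃ a b, IsQuadCap a b μ) ↔ IsCapacity μ ∧ IsSymmetricCap μ ∧
      (∀ A : Finset (Fin n), 2 < A.card → mobius μ A = 0) ∧
      (∀ A : Finset (Fin n), 0 ≤ mobius μ A) ∧
      (∀ A : Finset (Fin n), A.card = 2 → 0 < mobius μ A) := by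
  constructor
  · rintro ⟨a, b, h⟩
    refine ⟨h.isCapacity, h.isSymmetricCap, h.atMostAdditive, fun A => ?_, fun A hA => ?_⟩
    · rw [mobius_quadCap h.2.2.2]
      have := h.1
      have := h.2.1.le
      split_ifs <;> first | assumption | exact le_rfl
    · rw [mobius_quadCap h.2.2.2, if_neg (by omega), if_pos hA]
      exact h.2.1
  · rintro ⟨hc, hs, h2, -, hpos⟩
    obtain ⟨a, b, hμ⟩ := exists_quadCap_of_atMostAdditive hc.1 hs h2
    obtain ⟨A, hA⟩ := exists_finset_card (n := n) hn
    have hb := hpos A hA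
    rw [mobius_quadCap hμ, if_neg (by omega), if_pos hA] at hb
    exact ⟨a, b, of_quadCap hn hc hμ hb⟩

end IsQuadCap

lemma sum_filter_le_sub_succ (p : ℕ → ℝ) (hp : p 0 = 0) {n k : ℕ} (hk : k ≤ n) :
    ∑ i ∈ univ.filter (fun i : Fin n => n - k ≤ (i : ℕ)), (p (n - i) - p (n - (i + 1))) = p k := by
  rw [sum_filter, Fin.sum_univ_eq_sum_range
    (fun i => if n - k ≤ i then p (n - i) - p (n - (i + 1)) else 0), ← sum_filter]
  have : (range n).filter (fun i => n - k ≤ i) = Ico (n - k) n := by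
    ext i; simp only [mem_filter, mem_range, mem_Ico]; omega
  rw [this]
  have h := sum_Ico_sub (fun i => -p (n - i)) (show n - k ≤ n by omega)
  simp only [Nat.sub_self, hp, show n - (n - k) = k by omega] at h
  rw [← show -0 - -p k = p k by ring, ← h]
  exact sum_congr rfl fun i _ => by ring

lemma isWeightOf_sub {n : ℕ} {μ : Finset (Fin n) → ℝ} {p : ℕ → ℝ}
    (hμ : ∀ A, μ A = p A.card) (h0 : p 0 = 0) :
    IsWeightOf (fun i : Fin n => p (n - i) - p (n - (i + 1))) μ := fun T _ => by
  rw [hμ, sum_filter_le_sub_succ p h0 (by simpa using card_le_univ T)]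

lemma IsWeightOf.eq_sub {n : ℕ} {μ : Finset (Fin n) → ℝ} {w : Fin n → ℝ} {p : ℕ → ℝ}
    (hμ : ∀ A, μ A = p A.card) (h0 : p 0 = 0) (hw : IsWeightOf w μ) (i : Fin n) :
    w i = p (n - i) - p (n - (i + 1)) := by
  have hs : ∀ k ≤ n, ∑ j ∈ univ.filter (fun j : Fin n => n - k ≤ (j : ℕ)), w j = p k := by
    intro k hk
    rcases Nat.eq_zero_or_pos k with rfl | hpos
    · rw [h0, filter_false_of_mem, sum_empty]
      intro j _; have := j.isLt; omega
    · obtain ⟨A, hA⟩ := exists_finset_card hk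
      rw [← hA, ← hμ, hw A (card_pos.1 (by omega))]
  have hi := i.isLt
  rw [← hs (n - i) (by omega), ← hs (n - (i + 1)) (by omega), eq_sub_iff_add_eq]
  rw [← sum_insert]
  · refine sum_congr ?_ fun _ _ => rfl
    ext j
    simp only [mem_insert, mem_filter, mem_univ, true_and, Fin.ext_iff]
    omega
  · simp only [mem_filter, mem_univ, true_and]; omega

lemma IsQuadCap.exists_iff_weight {n : ℕ} (hn : 2 ≤ n) {μ : Finset (Fin n) → ℝ} :
    (∃ a b, IsQuadCap a b μ) ↔ IsCapacity μ ∧ IsSymmetricCap μ ∧ AtMostAdditive 2 μ ∧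
      ∃ w : Fin n → ℝ, IsWeightOf w μ ∧ ∀ i : ℕ, i + 1 < n → wAt w (i + 1) < wAt w i := by
  constructor
  · rintro ⟨a, b, h⟩
    refine ⟨h.isCapacity, h.isSymmetricCap, h.atMostAdditive, _,
      isWeightOf_sub h.2.2.2 (quadCap_zero a b), fun i hi => ?_⟩
    have hi' : i < n := by omega
    simp only [wAt, hi, hi', dif_pos, quadCap_sub a b hi, quadCap_sub a b hi']
    push_cast
    linarith [h.2.1]
  · rintro ⟨hc, hs, h2, w, hw, hlt⟩
    obtain ⟨a, b, hμ⟩ := exists_quadCap_of_atMostAdditive hc.1 hs h2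
    have h := hlt 0 (by omega)
    have h0 : 0 < n := by omega
    have h1 : 0 + 1 < n := by omega
    simp only [wAt, h0, h1, dif_pos, hw.eq_sub hμ (quadCap_zero a b), quadCap_sub a b h0,
      quadCap_sub a b h1] at h
    push_cast at h
    exact ⟨a, b, of_quadCap hn hc hμ (by linarith)⟩

lemma IsQuadCap.unique {n : ℕ} (hn : 2 ≤ n) {R : Pref n} {μ ν : Finset (Fin n) → ℝ}
    (hμ : ∃ a b, IsQuadCap a b μ) (hμR : Represents (choquet μ) R)
    (hν : ∃ a b, IsQuadCap a b ν) (hνR : Represents (choquet ν) R) : μ = ν := by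
  obtain ⟨a, b, -, -, h1, hμ⟩ := hμ
  obtain ⟨c, d, -, -, h2, hν⟩ := hν
  have hn0 : 0 < n := by omega
  have key : ∀ f g : Fin n → ℝ, pairMin a b g ≤ pairMin a b f ↔ pairMin c d g ≤ pairMin c d f := by
    intro f g
    rw [← choquet_eq_pairMin hμ, ← choquet_eq_pairMin hμ, ← choquet_eq_pairMin hν,
      ← choquet_eq_pairMin hν, ← hμR, ← hνR]
  have k1 := (key (Pi.single ⟨0, hn0⟩ 1) (fun _ => a)).1
    (by rw [pairMin_const, pairMin_single, h1, one_mul])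
  have k2 := (key (fun _ => a) (Pi.single ⟨0, hn0⟩ 1)).1
    (by rw [pairMin_const, pairMin_single, h1, one_mul])
  rw [pairMin_const, pairMin_single, h2, one_mul] at k1 k2
  have hac : a = c := le_antisymm k1 k2
  have hbd : b = d := by
    subst hac
    rw [← h2] at h1
    have hn' : (2 : ℝ) ≤ n := by exact_mod_cast hn
    have hpos : (n : ℝ) * (n - 1) / 2 ≠ 0 := by
      have : (0 : ℝ) < n * (n - 1) := mul_pos (by linarith) (by linarith)
      positivity
    exact mul_right_cancel₀ hpos (add_left_cancel h1)
  funext A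
  rw [hμ, hν, hac, hbd]

lemma strictP_iff_of_represents {n : ℕ} {V : (Fin n → ℝ) → ℝ} {R : Pref n}
    (h : Represents V R) (f g : Fin n → ℝ) : StrictP R f g ↔ V g < V f := by
  rw [StrictP, h, h, not_le]
  exact ⟨fun h => h.2, fun h => ⟨h.le, h⟩⟩

lemma axioms_of_represents_pairMin {n : ℕ} {R : Pref n} {a b : ℝ} (ha : 0 ≤ a) (hb : 0 < b)
    (h1 : quadCap a b n = 1) (hR : Represents (pairMin a b) R) :
    AxA1 R ∧ AxA2 R ∧ AxA3 R ∧ AxA4 R ∧ AxA5 R ∧ AxA6 R ∧ AxA7 R ∧ AxA8 R := by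
  refine ⟨⟨fun f g => ?_, fun f => ?_, fun f g h hfg hgh => ?_⟩, fun f => ⟨?_, ?_⟩,
    fun f π => ⟨?_, ?_⟩, fun f g h hf hg hh => ?_, fun f g h => ?_,
    ⟨fun _ => 1, fun _ => 0, ?_⟩, ?_, ?_⟩
  · rw [hR, hR]; exact le_total _ _
  · rw [hR]
  · rw [hR] at *; exact hgh.trans hfg
  · simp only [strictP_iff_of_represents hR]
    exact isOpen_lt continuous_const (continuous_pairMin a b)
  · simp only [strictP_iff_of_represents hR]
    exact isOpen_lt (continuous_pairMin a b) continuous_const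
  · rw [hR, pairMin_perm]
  · rw [hR, pairMin_perm]
  · rw [hR, hR, pairMin_of_monotone a b hf, pairMin_of_monotone a b hg,
      pairMin_of_monotone a b (f := f + h) (hf.add hh),
      pairMin_of_monotone a b (f := g + h) (hg.add hh)]
    simp only [Pi.add_apply, add_mul, sum_add_distrib, add_le_add_iff_right]
  · rw [hR]; exact pairMin_mono ha hb.le h
  · rw [strictP_iff_of_represents hR, pairMin_const, pairMin_const, h1]; norm_num
  · intro f f' g g' i j t ht hf hg hf' hg' hfi hgi hfj hgj hfl hgl
    rw [hR, hR, pairMin_transfer a b ht hf'.1.le hf.2 hfi hfj hfl,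
      pairMin_transfer a b ht hg'.1.le hg.2 hgi hgj hgl, add_le_add_iff_right]
  · intro f f' hf hf' i hi t ht hfi hfj hfl
    rw [strictP_iff_of_represents hR,
      pairMin_transfer a b ht (hf' (by simp [Fin.le_def])) ?_ hfi hfj hfl]
    · have := mul_pos hb ht
      linarith
    · rintro l ⟨h1, h2⟩
      have h3 : i < l := by
        by_contra h; exact h1.not_ge (hf (not_lt.1 h))
      have h4 : l < ⟨(i : ℕ) + 1, hi⟩ := by
        by_contra h; exact h2.not_ge (hf (not_lt.1 h))
      simp only [Fin.lt_def] at h3 h4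
      omega

lemma not_prefers_const_of_lt {n : ℕ} {R : Pref n} (h1 : AxA1 R) (h4 : AxA4 R) (h5 : AxA5 R)
    (h6 : AxA6 R) {c d : ℝ} (hcd : c < d) : ¬ R (fun _ => c) (fun _ => d) := by
  intro hR
  have shift : ∀ x y z : ℝ, R (fun _ => x) (fun _ => y) → R (fun _ => x + z) (fun _ => y + z) :=
    fun x y z h => (h4 _ _ (fun _ => z) monotone_const monotone_const monotone_const).1 h
  have he : 0 < d - c := sub_pos.2 hcd
  have h0 : R (fun _ => 0) (fun _ => d - c) := by
    have := shift _ _ (-c) hR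
    rwa [add_neg_cancel, ← sub_eq_add_neg] at this
  have hk : ∀ k : ℕ, R (fun _ => 0) (fun _ => k * (d - c)) := by
    intro k
    induction k with
    | zero => simpa using h1.2.1 (fun _ => 0)
    | succ k ih =>
      have := shift _ _ (d - c) ih
      rw [zero_add] at this
      convert h1.2.2 _ _ _ h0 this using 2
      push_cast; ring
  have hbound : ∀ f : Fin n → ℝ, ∃ k : ℕ, ∀ i, |f i| ≤ k * (d - c) := by
    intro f
    obtain ⟨k, hk⟩ := exists_nat_ge ((∑ i, |f i|) / (d - c))
    rw [div_le_iff₀ he] at hk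
    exact ⟨k, fun i => (single_le_sum (f := fun i => |f i|)
      (fun j _ => abs_nonneg _) (mem_univ i)).trans hk⟩
  obtain ⟨f, g, -, hfg⟩ := h6
  apply hfg
  obtain ⟨k, hkf⟩ := hbound f
  obtain ⟨l, hlg⟩ := hbound g
  have hf : R (fun _ => 0) f :=
    h1.2.2 _ _ _ (hk k) (h5 _ _ fun i => (le_abs_self _).trans (hkf i))
  have hg : R g (fun _ => 0) := by
    have := shift _ _ (-(l * (d - c))) (hk l)
    rw [zero_add, add_neg_cancel] at this
    exact h1.2.2 _ _ _ (h5 _ _ fun i => neg_le.1 ((neg_le_abs _).trans (hlg i))) this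
  exact h1.2.2 _ _ _ hg hf

lemma exists_indiff_const {n : ℕ} {R : Pref n} (h1 : AxA1 R) (h2 : AxA2 R)
    (h5 : AxA5 R) (f : Fin n → ℝ) : ∃ c : ℝ, IndiffP R f (fun _ => c) := by
  by_contra! hne
  have hcont : Continuous fun (c : ℝ) (_ : Fin n) => c := by fun_prop
  have hu := (h2 f).1.preimage hcont
  have hv := (h2 f).2.preimage hcont
  have hM : ∀ i, |f i| ≤ ∑ i, |f i| := fun i =>
    single_le_sum (f := fun i => |f i|) (fun j _ => abs_nonneg _) (mem_univ i)
  set M := ∑ i, |f i|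
  have hup : R (fun _ => M) f := h5 _ _ fun i => (le_abs_self _).trans (hM i)
  have hlow : R f (fun _ => -M) := h5 _ _ fun i => neg_le.1 ((neg_le_abs _).trans (hM i))
  obtain ⟨c, -, hcu, hcv⟩ := isPreconnected_univ (α := ℝ) _ _ hu hv
    (fun c _ => by
      by_cases h : R f (fun _ => c)
      · exact Or.inr ⟨h, fun h' => hne c ⟨h, h'⟩⟩
      · exact Or.inl ⟨(h1.1 f _).resolve_left h, h⟩)
    ⟨M, trivial, hup, fun h => hne M ⟨h, hup⟩⟩ ⟨-M, trivial, hlow, fun h => hne (-M) ⟨hlow, h⟩⟩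
  exact hcu.2 hcv.1

/-- The certainty equivalent represents the preference and is additive on nondecreasing acts. -/
lemma exists_certainty_equivalent {n : ℕ} {R : Pref n} (h1 : AxA1 R) (h2 : AxA2 R)
    (h4 : AxA4 R) (h5 : AxA5 R) (h6 : AxA6 R) :
    ∃ V : (Fin n → ℝ) → ℝ, Represents V R ∧ (∀ c, V (fun _ => c) = c) ∧
      ∀ f g, Monotone f → Monotone g → V (f + g) = V f + V g := by
  choose V hV using exists_indiff_const h1 h2 h5
  have hle : ∀ c d : ℝ, R (fun _ => c) (fun _ => d) ↔ d ≤ c := fun c d =>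
    ⟨fun h => not_lt.1 fun hlt => not_prefers_const_of_lt h1 h4 h5 h6 hlt h,
      fun h => h5 _ _ fun _ => h⟩
  have hrep : Represents V R := fun f g => by
    rw [← hle]
    exact ⟨fun h => h1.2.2 _ _ _ (hV f).2 (h1.2.2 _ _ _ h (hV g).1),
      fun h => h1.2.2 _ _ _ (hV f).1 (h1.2.2 _ _ _ h (hV g).2)⟩
  have hconst : ∀ c, V (fun _ => c) = c := fun c =>
    le_antisymm ((hle _ _).1 (hV fun _ => c).1) ((hle _ _).1 (hV fun _ => c).2)
  refine ⟨V, hrep, hconst, fun f g hf hg => ?_⟩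
  have e1 : IndiffP R (f + g) ((fun _ => V f) + g) :=
    ⟨(h4 _ _ _ hf monotone_const hg).1 (hV f).1, (h4 _ _ _ monotone_const hf hg).1 (hV f).2⟩
  have e2 : IndiffP R ((fun _ => V f) + g) (fun _ => V f + V g) := by
    rw [add_comm]
    have : (fun _ : Fin n => V f + V g) = (fun _ => V g) + fun _ => V f := by
      funext i; exact add_comm _ _
    rw [this]
    exact ⟨(h4 _ _ _ hg monotone_const monotone_const).1 (hV g).1,
      (h4 _ _ _ monotone_const hg monotone_const).1 (hV g).2⟩
  rw [← hconst (V f + V g)]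
  exact le_antisymm ((hrep _ _).1 (h1.2.2 _ _ _ e2.2 e1.2))
    ((hrep _ _).1 (h1.2.2 _ _ _ e1.1 e2.1))

/-- A monotone solution of Cauchy's equation on the nonnegative reals is linear. -/
lemma eq_mul_of_additive_of_monotone {φ : ℝ → ℝ}
    (hadd : ∀ s t, 0 ≤ s → 0 ≤ t → φ (s + t) = φ s + φ t)
    (hmono : ∀ s t, 0 ≤ s → s ≤ t → φ s ≤ φ t) {t : ℝ} (ht : 0 ≤ t) : φ t = t * φ 1 := by
  have h0 : φ 0 = 0 := by simpa using hadd 0 0 le_rfl le_rfl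
  have hmul : ∀ (k : ℕ) (s : ℝ), 0 ≤ s → φ (k * s) = k * φ s := by
    intro k s hs
    induction k with
    | zero => simpa using h0
    | succ k ih =>
      push_cast
      rw [add_mul, one_mul, hadd _ _ (by positivity) hs, ih]; ring
  have h1 : 0 ≤ φ 1 := h0 ▸ hmono 0 1 le_rfl zero_le_one
  have hN : ∀ N : ℕ, N * |φ t - t * φ 1| ≤ φ 1 := by
    intro N
    have hNt : 0 ≤ (N : ℝ) * t := by positivity
    have hm1 := Nat.floor_le hNt
    have hm2 := (Nat.lt_floor_add_one ((N : ℝ) * t)).le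
    set m := ⌊(N : ℝ) * t⌋₊
    have l1 := hmono (m * 1) _ (by positivity) (by rwa [mul_one] : (m : ℝ) * 1 ≤ N * t)
    have l2 := hmono _ ((m + 1 : ℕ) * 1) hNt (by push_cast; rwa [mul_one])
    rw [hmul _ _ zero_le_one, hmul _ _ ht] at l1
    rw [hmul _ _ zero_le_one, hmul _ _ ht] at l2
    push_cast at l2
    have l3 := mul_le_mul_of_nonneg_right hm1 h1
    have l4 := mul_le_mul_of_nonneg_right hm2 h1
    rw [← Nat.abs_cast, ← abs_mul, abs_le]
    constructor <;> linarith
  by_contra hne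
  have hpos : 0 < |φ t - t * φ 1| := abs_pos.2 (sub_ne_zero.2 hne)
  obtain ⟨N, hlt⟩ := exists_nat_gt (φ 1 / |φ t - t * φ 1|)
  rw [div_lt_iff₀ hpos] at hlt
  exact absurd (hN N) (not_le.2 hlt)

/-- The indicator act of a set of states. -/
noncomputable def indAct {n : ℕ} (A : Finset (Fin n)) : Fin n → ℝ :=
  fun x => if x ∈ A then 1 else 0

lemma monotone_indAct {n : ℕ} (i : Fin n) :
    Monotone (indAct (univ.filter fun j : Fin n => i ≤ j)) := by
  intro x y hxy
  simp only [indAct, mem_filter, mem_univ, true_and]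
  split_ifs with h1 h2
  · exact le_rfl
  · exact absurd (h1.trans hxy) h2
  · exact zero_le_one
  · exact le_rfl

lemma indAct_image_comp {n : ℕ} (σ : Equiv.Perm (Fin n)) (A : Finset (Fin n)) :
    indAct (A.image σ) ∘ σ = indAct A := by
  funext x
  simp [indAct]

/-- A symmetric monotone functional that fixes constants and is additive on nondecreasing acts is
the Choquet integral of its values on indicators. -/
lemma eq_choquet_of_additive {n : ℕ} {V : (Fin n → ℝ) → ℝ} (hconst : ∀ c, V (fun _ => c) = c)
    (hadd : ∀ f g, Monotone f → Monotone g → V (f + g) = V f + V g)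
    (hmono : ∀ f g, (∀ i, g i ≤ f i) → V g ≤ V f)
    (hperm : ∀ (f : Fin n → ℝ) (π : Equiv.Perm (Fin n)), V (f ∘ π) = V f) (f : Fin n → ℝ) :
    V f = choquet (fun A => V (indAct A)) f := by
  have hsum : ∀ (s : Finset (Fin n)) (F : Fin n → Fin n → ℝ), (∀ i, Monotone (F i)) →
      V (∑ i ∈ s, F i) = ∑ i ∈ s, V (F i) ∧ Monotone (∑ i ∈ s, F i) := by
    intro s F hF
    induction s using Finset.induction_on with
    | empty => exact ⟨hconst 0, monotone_const⟩
    | insert i s hi ih =>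
      rw [sum_insert hi, sum_insert hi, hadd _ _ (hF i) ih.2, ih.1]
      exact ⟨rfl, (hF i).add ih.2⟩
  set g : Fin n → ℝ := f ∘ Tuple.sort f with hg
  have hgm : Monotone g := Tuple.monotone_sort f
  let E : Fin n → Fin n → ℝ := fun i => indAct (univ.filter fun j : Fin n => i ≤ j)
  let d : Fin n → ℝ := fun i => g i - if (i : ℕ) = 0 then 0
    else g ⟨(i : ℕ) - 1, lt_of_le_of_lt (Nat.sub_le _ _) i.isLt⟩
  have hE0 : ∀ i : Fin n, (i : ℕ) = 0 → E i = fun _ => 1 := by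
    intro i hi
    funext x
    have : i ≤ x := by rw [Fin.le_def, hi]; exact Nat.zero_le _
    simp [E, indAct, this]
  have hd : ∀ i : Fin n, (i : ℕ) ≠ 0 → 0 ≤ d i := by
    intro i hi
    simp only [d, if_neg hi, sub_nonneg]
    exact hgm (by rw [Fin.le_def]; exact Nat.sub_le _ _)
  have hmon : ∀ (i : Fin n) (t : ℝ), 0 ≤ t → Monotone (t • E i) := fun i t ht x y hxy =>
    mul_le_mul_of_nonneg_left (monotone_indAct i hxy) ht
  have hterm : ∀ i, Monotone (d i • E i) ∧ V (d i • E i) = d i * V (E i) := by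
    intro i
    by_cases hi : (i : ℕ) = 0
    · have : d i • E i = fun _ => d i := by
        rw [hE0 i hi]; funext x; simp
      rw [this, hE0 i hi, hconst, hconst, mul_one]
      exact ⟨monotone_const, rfl⟩
    · refine ⟨hmon i _ (hd i hi), ?_⟩
      have h := eq_mul_of_additive_of_monotone (φ := fun t => V (t • E i))
        (fun s t hs ht => by
          simp only [add_smul]
          exact hadd _ _ (hmon i s hs) (hmon i t ht))
        (fun s t _ hst => hmono _ _ fun x => by
          simp only [Pi.smul_apply, smul_eq_mul]
          refine mul_le_mul_of_nonneg_right hst ?_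
          simp only [E, indAct]
          split_ifs <;> norm_num) (hd i hi)
      simpa using h
  have hgE : g = ∑ i, d i • E i := by
    funext x
    have h := sum_fin_increment_mul g (fun k => if k ≤ (x : ℕ) then 1 else 0)
      (if_neg (Nat.not_le.2 x.isLt))
    rw [Finset.sum_apply]
    have h' : ∀ i, (d i • E i) x = d i * (if (i : ℕ) ≤ (x : ℕ) then 1 else 0) := by
      intro i
      simp only [E, indAct, Pi.smul_apply, smul_eq_mul, mem_filter, mem_univ, true_and,
        Fin.le_def]
    simp only [h', d]
    rw [h, sum_eq_single x]
    · simp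
    · intro i _ hi
      have : (i : ℕ) ≠ x := fun h => hi (Fin.ext h)
      by_cases hlt : (i : ℕ) < x
      · rw [if_pos hlt.le, if_pos (Nat.succ_le_of_lt hlt)]; ring
      · rw [if_neg (by omega), if_neg (by omega)]; ring
    · simp
  rw [← hperm f (Tuple.sort f), ← hg, hgE, (hsum _ _ fun i => (hterm i).1).1, choquet]
  refine sum_congr rfl fun i _ => ?_
  rw [(hterm i).2]
  congr 1
  rw [← hperm (indAct (image _ _)) (Tuple.sort f), indAct_image_comp]

lemma exists_perm_image_eq {n : ℕ} {A B : Finset (Fin n)} (h : A.card = B.card) :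
    ∃ σ : Equiv.Perm (Fin n), A.image σ = B := by
  let e : {x // x ∈ A} ≃ {x // x ∈ B} := equivOfCardEq h
  refine ⟨e.extendSubtype, eq_of_subset_of_card_le ?_ ?_⟩
  · intro y hy
    obtain ⟨x, hx, rfl⟩ := mem_image.1 hy
    rw [Equiv.extendSubtype_apply_of_mem e x hx]
    exact (e ⟨x, hx⟩).2
  · rw [card_image_of_injective _ e.extendSubtype.injective, h]

/-- Axioms A1-A6 yield a representation by the Choquet integral of a symmetric capacity. -/
lemma exists_symmetric_choquet {n : ℕ} {R : Pref n} (h1 : AxA1 R) (h2 : AxA2 R) (h3 : AxA3 R)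
    (h4 : AxA4 R) (h5 : AxA5 R) (h6 : AxA6 R) :
    ∃ μ : Finset (Fin n) → ℝ, IsCapacity μ ∧ IsSymmetricCap μ ∧ Represents (choquet μ) R := by
  obtain ⟨V, hrep, hconst, hadd⟩ := exists_certainty_equivalent h1 h2 h4 h5 h6
  have hmono : ∀ f g, (∀ i, g i ≤ f i) → V g ≤ V f := fun f g h => (hrep _ _).1 (h5 _ _ h)
  have hperm : ∀ (f : Fin n → ℝ) (π : Equiv.Perm (Fin n)), V (f ∘ π) = V f := fun f π =>
    le_antisymm ((hrep _ _).1 (h3 f π).1) ((hrep _ _).1 (h3 f π).2)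
  have hV := funext (eq_choquet_of_additive hconst hadd hmono hperm)
  refine ⟨fun A => V (indAct A), ⟨?_, ?_, fun A B hAB => hmono _ _ fun i => ?_⟩,
    fun A B hAB => ?_, hV ▸ hrep⟩
  · exact (congrArg V (funext fun _ => by simp [indAct])).trans (hconst 0)
  · exact (congrArg V (funext fun _ => by simp [indAct])).trans (hconst 1)
  · simp only [indAct]
    split_ifs with hA hB
    · exact le_rfl
    · exact absurd (hAB hA) hB
    · exact zero_le_one
    · exact le_rfl
  · obtain ⟨σ, rfl⟩ := exists_perm_image_eq hAB
    simp only
    rw [← hperm (indAct (A.image σ)) σ, indAct_image_comp]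

lemma exists_perm_apply_pair {α : Type*} [DecidableEq α] {x y z w : α} (hxy : x ≠ y)
    (hzw : z ≠ w) : ∃ π : Equiv.Perm α, π x = z ∧ π y = w := by
  have hne : Equiv.swap x z y ≠ z := fun h => hxy ((Equiv.swap x z).injective
    (by rw [h, Equiv.swap_apply_left]))
  refine ⟨(Equiv.swap x z).trans (Equiv.swap (Equiv.swap x z y) w), ?_, ?_⟩
  · rw [Equiv.trans_apply, Equiv.swap_apply_left, Equiv.swap_apply_of_ne_of_ne hne.symm hzw]
  · rw [Equiv.trans_apply, Equiv.swap_apply_left]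

lemma StrictMono.precedes_succ {n : ℕ} {f : Fin n → ℝ} (hf : StrictMono f) {k : ℕ}
    (hk : k + 1 < n) : Precedes f ⟨k, by omega⟩ ⟨k + 1, hk⟩ := by
  refine ⟨hf (by simp [Fin.lt_def]), fun l ⟨h1, h2⟩ => ?_⟩
  rw [hf.lt_iff_lt, Fin.lt_def] at h1 h2
  simp only at h1 h2
  omega

lemma Precedes.comp_perm {n : ℕ} {f : Fin n → ℝ} {π : Equiv.Perm (Fin n)} {i j : Fin n}
    (h : Precedes f (π i) (π j)) : Precedes (f ∘ π) i j :=
  ⟨h.1, fun l => h.2 (π l)⟩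

/-- The act with equally spaced coordinates `3 * x`. -/
noncomputable def ladderAct (n : ℕ) : Fin n → ℝ := fun x => 3 * (x : ℕ)

/-- `ladderAct n` after a unit transfer from coordinate `k + 1` to coordinate `k`. -/
noncomputable def ladderTransfer (n k : ℕ) : Fin n → ℝ := fun x =>
  ladderAct n x + (if (x : ℕ) = k then 1 else 0) - (if (x : ℕ) = k + 1 then 1 else 0)

lemma strictMono_ladderAct (n : ℕ) : StrictMono (ladderAct n) := by
  intro x y hxy
  have : (x : ℝ) < (y : ℕ) := by exact_mod_cast hxy
  simp only [ladderAct]; linarith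

lemma strictMono_ladderTransfer (n k : ℕ) : StrictMono (ladderTransfer n k) := by
  intro x y hxy
  have h : ((x : ℕ) : ℝ) + 1 ≤ (y : ℕ) := by exact_mod_cast hxy
  simp only [ladderTransfer, ladderAct]
  have hlt : (x : ℕ) < y := hxy
  split_ifs <;> linarith

lemma ladderTransfer_left {n k : ℕ} (h : k < n) :
    ladderTransfer n k ⟨k, h⟩ = ladderAct n ⟨k, h⟩ + 1 := by simp [ladderTransfer]

lemma ladderTransfer_right {n k : ℕ} (h : k + 1 < n) :
    ladderTransfer n k ⟨k + 1, h⟩ = ladderAct n ⟨k + 1, h⟩ - 1 := by simp [ladderTransfer]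

lemma ladderTransfer_other {n k : ℕ} {x : Fin n} (h1 : (x : ℕ) ≠ k) (h2 : (x : ℕ) ≠ k + 1) :
    ladderTransfer n k x = ladderAct n x := by simp [ladderTransfer, h1, h2]

lemma choquet_ladderTransfer {n k : ℕ} (hk : k + 1 < n) {μ : Finset (Fin n) → ℝ} {p : ℕ → ℝ}
    (hμ : ∀ A, μ A = p A.card) (h0 : p 0 = 0) :
    choquet μ (ladderTransfer n k) = choquet μ (ladderAct n) +
      ((p (n - k) - p (n - (k + 1))) - (p (n - (k + 1)) - p (n - (k + 1 + 1)))) := by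
  rw [choquet_eq_sum hμ h0, choquet_eq_sum hμ h0]
  simp only [comp_sort_of_monotone (strictMono_ladderTransfer n k).monotone,
    comp_sort_of_monotone (strictMono_ladderAct n).monotone]
  simp only [ladderTransfer, sub_mul, add_mul, sum_sub_distrib, sum_add_distrib]
  have hs : ∀ (m : ℕ) (hm : m < n) (w : ℕ → ℝ),
      ∑ x : Fin n, (if (x : ℕ) = m then (1 : ℝ) else 0) * w x = w m := by
    intro m hm w
    rw [sum_eq_single ⟨m, hm⟩]
    · simp
    · intro x _ hx
      rw [if_neg fun h => hx (Fin.ext h), zero_mul]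
    · simp
  rw [hs k (by omega) fun i => p (n - i) - p (n - (i + 1)),
    hs (k + 1) hk fun i => p (n - i) - p (n - (i + 1))]
  ring

/-- A8 makes every elementary transfer on the ladder strictly improving. -/
lemma AxA8.strictP_ladderTransfer {n k : ℕ} {R : Pref n} (h : AxA8 R) (hk : k + 1 < n) :
    StrictP R (ladderTransfer n k) (ladderAct n) :=
  h _ _ (strictMono_ladderAct n).monotone (strictMono_ladderTransfer n k).monotone
    ⟨k, by omega⟩ hk 1 one_pos (ladderTransfer_left _) (ladderTransfer_right hk)
    fun _ h1 h2 => ladderTransfer_other (fun h => h1 (Fin.ext h)) fun h => h2 (Fin.ext h)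

/-- A3 and A7 make all elementary transfers on the ladder indifferent. -/
lemma AxA7.indiffP_ladderTransfer {n k l : ℕ} {R : Pref n} (h1 : AxA1 R) (h3 : AxA3 R)
    (h7 : AxA7 R) (hk : k + 1 < n) (hl : l + 1 < n) :
    R (ladderTransfer n k) (ladderTransfer n l) := by
  have hk' : k < n := by omega
  have hl' : l < n := by omega
  obtain ⟨π, hπ1, hπ2⟩ := exists_perm_apply_pair
    (x := (⟨k, hk'⟩ : Fin n)) (y := ⟨k + 1, hk⟩) (z := ⟨l, hl'⟩) (w := ⟨l + 1, hl⟩)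
    (by simp) (by simp)
  have hp : ∀ f : Fin n → ℝ, StrictMono f →
      Precedes (f ∘ π) ⟨k, hk'⟩ ⟨k + 1, hk⟩ := fun f hf =>
    Precedes.comp_perm (by rw [hπ1, hπ2]; exact hf.precedes_succ hl)
  refine h1.2.2 _ (ladderTransfer n l ∘ π) _ ?_ (h3 _ π).2
  refine (h7 (ladderAct n) _ (ladderAct n ∘ π) _ ⟨k, hk'⟩ ⟨k + 1, hk⟩ 1 one_pos
    ((strictMono_ladderAct n).precedes_succ hk) (hp _ (strictMono_ladderAct n))
    ((strictMono_ladderTransfer n k).precedes_succ hk) (hp _ (strictMono_ladderTransfer n l))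
    (ladderTransfer_left _) ?_ (ladderTransfer_right hk) ?_ ?_ ?_).1 (h3 _ π).1
  · simp only [Function.comp, hπ1, ladderTransfer_left]
  · simp only [Function.comp, hπ2, ladderTransfer_right]
  · exact fun x hx1 hx2 =>
      ladderTransfer_other (fun h => hx1 (Fin.ext h)) fun h => hx2 (Fin.ext h)
  · intro x hx1 hx2
    refine ladderTransfer_other (fun h => hx1 (π.injective ?_)) fun h => hx2 (π.injective ?_)
    · rw [hπ1]; exact Fin.ext h
    · rw [hπ2]; exact Fin.ext h

lemma eq_quadCap_of_second_difference {n : ℕ} {p : ℕ → ℝ} {b : ℝ} (h0 : p 0 = 0)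
    (h : ∀ m, m + 2 ≤ n → (p (m + 2) - p (m + 1)) - (p (m + 1) - p m) = b) {m : ℕ}
    (hm : m ≤ n) : p m = quadCap (p 1) b m := by
  have hd : ∀ m, m + 1 ≤ n → p (m + 1) - p m = p 1 + b * m := by
    intro m
    induction m with
    | zero => intro _; simp [h0]
    | succ m ih =>
      intro hm
      have h1 := ih (by omega)
      have h2 := h m hm
      push_cast
      rw [show m + 1 + 1 = m + 2 from rfl]
      linarith
  induction m with
  | zero => rw [h0, quadCap_zero]
  | succ m ih =>
    have h1 := ih (by omega)
    have h2 := hd m hm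
    simp only [quadCap] at *
    push_cast
    linarith

lemma exists_isQuadCap_of_axioms {n : ℕ} (hn : 2 ≤ n) {R : Pref n} (h1 : AxA1 R) (h2 : AxA2 R)
    (h3 : AxA3 R) (h4 : AxA4 R) (h5 : AxA5 R) (h6 : AxA6 R) (h7 : AxA7 R) (h8 : AxA8 R) :
    ∃ μ : Finset (Fin n) → ℝ, (∃ a b, IsQuadCap a b μ) ∧ Represents (choquet μ) R := by
  obtain ⟨μ, hc, hs, hR⟩ := exists_symmetric_choquet h1 h2 h3 h4 h5 h6
  obtain ⟨p, hμ⟩ := hs.exists_card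
  have h0 : p 0 = 0 := by rw [← hc.1, hμ, card_empty]
  have hlt : 0 + 1 < n := by omega
  have hpos := (strictP_iff_of_represents hR _ _).1 (h8.strictP_ladderTransfer hlt)
  rw [choquet_ladderTransfer hlt hμ h0] at hpos
  have heq : ∀ k, k + 1 < n →
      choquet μ (ladderTransfer n k) = choquet μ (ladderTransfer n 0) := fun k hk =>
    le_antisymm ((hR _ _).1 (h7.indiffP_ladderTransfer h1 h3 hlt hk))
      ((hR _ _).1 (h7.indiffP_ladderTransfer h1 h3 hk hlt))
  have hquad : ∀ A, μ A = quadCap (p 1)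
      ((p (n - 0) - p (n - (0 + 1))) - (p (n - (0 + 1)) - p (n - (0 + 1 + 1)))) A.card := by
    intro A
    rw [hμ]
    refine eq_quadCap_of_second_difference h0 (fun m hm => ?_) (by simpa using card_le_univ A)
    have h := heq (n - (m + 2)) (by omega)
    rw [choquet_ladderTransfer (by omega) hμ h0, choquet_ladderTransfer hlt hμ h0,
      add_right_inj] at h
    rw [← h, show n - (n - (m + 2)) = m + 2 by omega,
      show n - (n - (m + 2) + 1) = m + 1 by omega,
      show n - (n - (m + 2) + 1 + 1) = m by omega]
  exact ⟨μ, ⟨_, _, IsQuadCap.of_quadCap hn hc hquad (by linarith)⟩, hR⟩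

lemma axioms_iff_existsUnique {n : ℕ} (hn : 2 ≤ n) (R : Pref n) :
    (AxA1 R ∧ AxA2 R ∧ AxA3 R ∧ AxA4 R ∧ AxA5 R ∧ AxA6 R ∧ AxA7 R ∧ AxA8 R) ↔
      ∃! μ : Finset (Fin n) → ℝ, (∃ a b, IsQuadCap a b μ) ∧ Represents (choquet μ) R := by
  constructor
  · rintro ⟨h1, h2, h3, h4, h5, h6, h7, h8⟩
    obtain ⟨μ, hμ, hR⟩ := exists_isQuadCap_of_axioms hn h1 h2 h3 h4 h5 h6 h7 h8
    exact ⟨μ, ⟨hμ, hR⟩, fun ν hν => IsQuadCap.unique hn hν.1 hν.2 hμ hR⟩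
  · rintro ⟨μ, ⟨⟨a, b, ha, hb, h1, hμ⟩, hR⟩, -⟩
    rw [funext (choquet_eq_pairMin hμ)] at hR
    exact axioms_of_represents_pairMin ha hb h1 hR

/-- A1–A8 characterize preferences represented by the Choquet integral of an at
most 2-additive symmetric capacity with strictly decreasing weights, equivalently of a
2-additive symmetric belief function. -/
theorem stmt_8 (n : ℕ) (hn : 2 ≤ n) (R : Pref n) :
    ((AxA1 R ∧ AxA2 R ∧ AxA3 R ∧ AxA4 R ∧ AxA5 R ∧ AxA6 R ∧ AxA7 R ∧ AxA8 R) ↔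
      (∃! μ : Finset (Fin n) → ℝ, IsCapacity μ ∧ IsSymmetricCap μ ∧ AtMostAdditive 2 μ ∧
        (∃ w : Fin n → ℝ, IsWeightOf w μ ∧ ∀ i : ℕ, i + 1 < n → wAt w (i + 1) < wAt w i) ∧
        Represents (choquet μ) R)) ∧
    ((∃! μ : Finset (Fin n) → ℝ, IsCapacity μ ∧ IsSymmetricCap μ ∧ AtMostAdditive 2 μ ∧
        (∃ w : Fin n → ℝ, IsWeightOf w μ ∧ ∀ i : ℕ, i + 1 < n → wAt w (i + 1) < wAt w i) ∧
        Represents (choquet μ) R) ↔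
      (∃! μ : Finset (Fin n) → ℝ, IsCapacity μ ∧ IsSymmetricCap μ ∧
        (∀ A : Finset (Fin n), 2 < A.card → mobius μ A = 0) ∧
        (∀ A : Finset (Fin n), 0 ≤ mobius μ A) ∧
        (∀ A : Finset (Fin n), A.card = 2 → 0 < mobius μ A) ∧
        Represents (choquet μ) R)) := by
  have h2 := existsUnique_congr fun μ : Finset (Fin n) → ℝ =>
    and_congr_left' (c := Represents (choquet μ) R) (IsQuadCap.exists_iff_weight hn (μ := μ))
  have h3 := existsUnique_congr fun μ : Finset (Fin n) → ℝ =>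
    and_congr_left' (c := Represents (choquet μ) R) (IsQuadCap.exists_iff_belief hn (μ := μ))
  simp only [and_assoc] at h2 h3
  exact ⟨(axioms_iff_existsUnique hn R).trans h2, h2.symm.trans h3⟩
end

section
/- Let 1 ≤ k ≤ n and let μ be a symmetric capacity on X = {1,…,n} with Möbius transform m and weight vector w. If μ is at most k-additive (m(A) = 0 for |A| > k), then for every i = 1,…,n−k+1 the alternating sum Σ_{j=0}^{k−1} (−1)^j C(k−1,j) w_{i+j} is equal to the same constant c_k, and moreover c_k = m(A) for every A with |A| = k. -/
open Finset

/-- The sum of the last `t` entries of `w`. -/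
noncomputable def tailSum {n : ℕ} (w : Fin n → ℝ) (t : ℕ) : ℝ :=
  ∑ i ∈ Finset.univ.filter (fun i : Fin n => n - t ≤ (i : ℕ)), w i

lemma tailSum_zero {n : ℕ} (w : Fin n → ℝ) : tailSum w 0 = 0 := by
  refine Finset.sum_eq_zero fun i hi => ?_
  have := (Finset.mem_filter.1 hi).2
  have := i.isLt
  omega

lemma IsWeightOf.eq_tailSum {n : ℕ} {w : Fin n → ℝ} {μ : Finset (Fin n) → ℝ}
    (hw : IsWeightOf w μ) (h0 : μ ∅ = 0) (T : Finset (Fin n)) : μ T = tailSum w T.card := by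
  rcases T.eq_empty_or_nonempty with rfl | hT
  · rw [h0, Finset.card_empty, tailSum_zero]
  · exact hw T hT

lemma fwdDiff_tailSum {n : ℕ} (w : Fin n → ℝ) {t : ℕ} (ht : t < n) :
    fwdDiff 1 (tailSum w) t = wAt w (n - 1 - t) := by
  have hlt : n - 1 - t < n := by omega
  have hset : Finset.univ.filter (fun i : Fin n => n - (t + 1) ≤ (i : ℕ)) =
      insert ⟨n - 1 - t, hlt⟩ (Finset.univ.filter (fun i : Fin n => n - t ≤ (i : ℕ))) := by
    ext i
    simp only [Finset.mem_filter, Finset.mem_univ, true_and, Finset.mem_insert, Fin.ext_iff]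
    omega
  rw [fwdDiff, tailSum, tailSum, hset, Finset.sum_insert, wAt, dif_pos hlt, add_sub_cancel_right]
  simp only [Finset.mem_filter, Finset.mem_univ, true_and]
  omega

lemma mobius_eq_fwdDiff_iter {n : ℕ} {μ : Finset (Fin n) → ℝ} {F : ℕ → ℝ}
    (hF : ∀ T, μ T = F T.card) (A : Finset (Fin n)) :
    mobius μ A = (fwdDiff 1)^[A.card] F 0 := by
  rw [mobius, fwdDiff_iter_eq_sum_shift]
  simp only [hF]
  rw [Finset.sum_powerset_apply_card (fun j => (-1 : ℝ) ^ (A.card - j) * F j)]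
  refine Finset.sum_congr rfl fun j _ => ?_
  simp only [nsmul_eq_mul, zsmul_eq_mul, smul_eq_mul, mul_one, zero_add]
  push_cast
  ring

lemma altSum_eq_fwdDiff_iter {n : ℕ} (w : Fin n → ℝ) (k y : ℕ) (h : y + (k + 1) ≤ n) :
    altSum w (k + 1) (n - k - y) = (fwdDiff 1)^[k + 1] (tailSum w) y := by
  rw [Function.iterate_succ_apply, fwdDiff_iter_eq_sum_shift, altSum, ← Finset.sum_range_reflect]
  refine Finset.sum_congr rfl fun j hj => ?_
  have hj' : j ≤ k := Nat.lt_succ_iff.1 (Finset.mem_range.1 hj)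
  rw [smul_eq_mul, mul_one, fwdDiff_tailSum w (by omega)]
  simp only [Nat.add_sub_cancel]
  rw [Nat.choose_symm hj', show n - k - y - 1 + (k - j) = n - 1 - (y + j) by omega]
  simp

/-- If the forward differences of order `k + 1, …, k + y` vanish at `0`, then the `k`-th forward
difference takes the same value at `y` as at `0`. -/
lemma fwdDiff_iter_eq_of_higher_eq_zero {F : ℕ → ℝ} {k y : ℕ}
    (h : ∀ l, 1 ≤ l → l ≤ y → (fwdDiff 1)^[l + k] F 0 = 0) :
    (fwdDiff 1)^[k] F y = (fwdDiff 1)^[k] F 0 := by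
  have := shift_eq_sum_fwdDiff_iter 1 ((fwdDiff 1)^[k] F) y 0
  rw [zero_add, smul_eq_mul, mul_one] at this
  rw [this, Finset.sum_eq_single 0]
  · simp
  · intro l hl hl0
    rw [← Function.iterate_add_apply, h l (Nat.pos_of_ne_zero hl0)
      (Nat.lt_succ_iff.1 (Finset.mem_range.1 hl)), smul_zero]
  · simp

/-- if a symmetric capacity is at most k-additive, the alternating sums
`Σ_{j=0}^{k-1} (-1)^j C(k-1,j) w_{i+j}` are constant in `i`, equal to `m(A)` for `|A| = k`. -/
theorem stmt_9 (n k : ℕ) (hk1 : 1 ≤ k) (hkn : k ≤ n) (μ : Finset (Fin n) → ℝ)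
    (hμ : IsCapacity μ) (hs : IsSymmetricCap μ) (w : Fin n → ℝ) (hw : IsWeightOf w μ)
    (hadd : AtMostAdditive k μ) :
    ∃ c : ℝ, (∀ i : ℕ, 1 ≤ i → i ≤ n - k + 1 → altSum w k i = c) ∧
      (∀ A : Finset (Fin n), A.card = k → mobius μ A = c) := by
  have hF := hw.eq_tailSum hμ.1
  refine ⟨(fwdDiff 1)^[k] (tailSum w) 0, fun i hi1 hi2 => ?_, fun A hA => ?_⟩
  · obtain ⟨k, rfl⟩ := Nat.exists_eq_succ_of_ne_zero (Nat.one_le_iff_ne_zero.1 hk1)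
    have hi : i = n - k - (n - k - i) := by omega
    rw [hi, altSum_eq_fwdDiff_iter w k _ (by omega)]
    refine fwdDiff_iter_eq_of_higher_eq_zero fun l hl1 hl2 => ?_
    obtain ⟨A, -, hA⟩ := Finset.exists_subset_card_eq
      (s := (Finset.univ : Finset (Fin n))) (n := l + (k + 1)) (by
        rw [Finset.card_univ, Fintype.card_fin]
        omega)
    rw [← hA, ← mobius_eq_fwdDiff_iter hF]
    exact hadd A (by omega)
  · rw [← hA, mobius_eq_fwdDiff_iter hF]
end

section
/- Let 1 ≤ k ≤ n and let μ be a symmetric capacity on X = {1,…,n} with weight vector w. If Σ_{j=0}^{k−1} (−1)^j C(k−1,j) w_{i+j} = Σ_{j=0}^{k−1} (−1)^j C(k−1,j) w_{l+j} for all i, l = 1,…,n−k+1, then μ is at most k-additive, i.e. its Möbius transform vanishes on every set of cardinality greater than k. -/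
open Finset

/-- A function which is constant on `0, …, m` has vanishing `m`-th difference at `0`, for `m ≠ 0`. -/
lemma fwdDiff_iter_zero_of_eq_on_range {v : ℕ → ℝ} {m : ℕ} (hm : m ≠ 0)
    (hv : ∀ s ≤ m, v s = v 0) : (fwdDiff 1)^[m] v 0 = 0 := by
  have hconst : (fwdDiff 1)^[m] (fun _ : ℕ => v 0) 0 = 0 := by
    obtain ⟨r, rfl⟩ := Nat.exists_eq_succ_of_ne_zero hm
    rw [Function.iterate_succ_apply, fwdDiff_const]
    simp [fwdDiff_iter_eq_sum_shift]
  rw [← hconst, fwdDiff_iter_eq_sum_shift, fwdDiff_iter_eq_sum_shift]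
  refine Finset.sum_congr rfl fun j hj => ?_
  rw [Finset.mem_range] at hj
  rw [hv (0 + j • 1) (by simp; omega)]

/-- A set function with weight vector `w` is a sum of the last entries of `w`. -/
lemma IsWeightOf.eq_sum_range {n : ℕ} {w : Fin n → ℝ} {μ : Finset (Fin n) → ℝ}
    (hw : IsWeightOf w μ) (h0 : μ ∅ = 0) (T : Finset (Fin n)) :
    μ T = ∑ s ∈ Finset.range T.card, wAt w (n - 1 - s) := by
  rcases T.eq_empty_or_nonempty with rfl | hT
  · simpa using h0
  have hc : T.card ≤ n := by simpa using T.card_le_univ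
  have hfin : ∀ i : Fin n, (if n - T.card ≤ (i : ℕ) then w i else 0) =
      (fun i : ℕ => if n - T.card ≤ i then wAt w i else 0) i := by
    intro i
    simp [wAt]
  rw [hw T hT, Finset.sum_filter, Finset.sum_congr rfl fun i _ => hfin i,
    Fin.sum_univ_eq_sum_range (fun i : ℕ => if n - T.card ≤ i then wAt w i else 0),
    ← Finset.sum_range_reflect,
    ← Finset.sum_subset (Finset.range_mono hc)]
  · refine Finset.sum_congr rfl fun j hj => ?_
    rw [Finset.mem_range] at hj
    exact if_pos (by omega)
  · intro j hj hj'
    rw [Finset.mem_range] at hj hj'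
    exact if_neg (by omega)

/-- The alternating sums are the iterated differences of the reversed weights. -/
lemma fwdDiff_iter_wAt_reverse {n k s : ℕ} (hk : 1 ≤ k) (hs : s + k ≤ n) (w : Fin n → ℝ) :
    (fwdDiff 1)^[k - 1] (fun t => wAt w (n - 1 - t)) s = altSum w k (n - k - s + 1) := by
  rw [fwdDiff_iter_eq_sum_shift, altSum, Nat.sub_add_cancel hk, ← Finset.sum_range_reflect]
  refine Finset.sum_congr rfl fun j hj => ?_
  rw [Finset.mem_range] at hj
  have h1 : k - 1 - (k - 1 - j) = j := by omega
  have h2 : n - 1 - (s + (k - 1 - j) • 1) = n - k - s + 1 - 1 + j := by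
    simp only [smul_eq_mul, mul_one]
    omega
  rw [h1, h2, Nat.choose_symm (by omega), zsmul_eq_mul]
  push_cast
  rfl

/-- if the alternating sums of the weights of a symmetric capacity are constant,
then the capacity is at most k-additive. -/
theorem stmt_10 (n k : ℕ) (hk1 : 1 ≤ k) (hkn : k ≤ n) (μ : Finset (Fin n) → ℝ)
    (hμ : IsCapacity μ) (hs : IsSymmetricCap μ) (w : Fin n → ℝ) (hw : IsWeightOf w μ)
    (h : ∀ i l : ℕ, 1 ≤ i → i ≤ n - k + 1 → 1 ≤ l → l ≤ n - k + 1 →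
      altSum w k i = altSum w k l) :
    AtMostAdditive k μ := by
  intro A hA
  have hAn : A.card ≤ n := by simpa using A.card_le_univ
  set u : ℕ → ℝ := fun t => wAt w (n - 1 - t)
  have hdiff : fwdDiff 1 (fun c => ∑ s ∈ Finset.range c, u s) = u := by
    funext c
    simp [fwdDiff, Finset.sum_range_succ]
  have hcard : A.card = (A.card - k) + (k - 1) + 1 := by omega
  rw [mobius_eq_fwdDiff_iter (F := fun c => ∑ s ∈ Finset.range c, u s)
      (hw.eq_sum_range hμ.1), hcard, Function.iterate_succ_apply, hdiff,
    Function.iterate_add_apply]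
  refine fwdDiff_iter_zero_of_eq_on_range (by omega) fun s hs' => ?_
  rw [fwdDiff_iter_wAt_reverse hk1 (by omega), fwdDiff_iter_wAt_reverse hk1 (by omega)]
  exact h _ _ (by omega) (by omega) (by omega) (by omega)
end

section
/- Let 1 ≤ k ≤ n, let μ be a symmetric capacity on X = {1,…,n} with weight vector w, and let A ⊆ X with |A| ≥ k. Then for every subset S = {i_1,…,i_k} ⊆ A of cardinality k, Σ_{B⊆S} (−1)^{|B|} μ(A∖B) = Σ_{j=0}^{k−1} (−1)^j C(k−1,j) w_{n−|A|+j+1}. -/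
open Finset

theorem sum_range_choose_succ_alternating {R : Type*} [CommRing R] (g : ℕ → R) (k : ℕ) :
    ∑ m ∈ Finset.range (k + 2), (-1 : R) ^ m * ((k + 1).choose m : R) * g m =
      ∑ m ∈ Finset.range (k + 1), (-1 : R) ^ m * (k.choose m : R) * (g m - g (m + 1)) := by
  have h : ∑ m ∈ Finset.range (k + 1), (-1 : R) ^ m * (k.choose m : R) * g m =
      ∑ m ∈ Finset.range (k + 1), (-1 : R) ^ (m + 1) * (k.choose (m + 1) : R) * g (m + 1) + g 0 := by
    rw [Finset.sum_range_succ', Finset.sum_range_succ _ k]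
    simp
  simp_rw [mul_sub]
  rw [Finset.sum_range_succ', Finset.sum_sub_distrib, h, add_sub_right_comm,
    ← Finset.sum_sub_distrib]
  congr 1
  · refine Finset.sum_congr rfl fun m _ => ?_
    rw [Nat.choose_succ_succ]
    push_cast
    ring
  · simp

theorem sum_filter_le_eq_wAt_add {n : ℕ} (w : Fin n → ℝ) {i : ℕ} (hi : i < n) :
    ∑ x ∈ Finset.univ.filter (fun x : Fin n => i ≤ (x : ℕ)), w x =
      wAt w i + ∑ x ∈ Finset.univ.filter (fun x : Fin n => i + 1 ≤ (x : ℕ)), w x := by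
  have h : Finset.univ.filter (fun x : Fin n => i ≤ (x : ℕ)) =
      insert ⟨i, hi⟩ (Finset.univ.filter (fun x : Fin n => i + 1 ≤ (x : ℕ))) := by
    ext x
    simp only [Finset.mem_filter, Finset.mem_univ, true_and, Finset.mem_insert, Fin.ext_iff]
    omega
  rw [h, Finset.sum_insert (by simp), wAt, dif_pos hi]

theorem IsWeightOf.eq_sum_filter {n : ℕ} {w : Fin n → ℝ} {μ : Finset (Fin n) → ℝ}
    (hw : IsWeightOf w μ) (h0 : μ ∅ = 0) (T : Finset (Fin n)) :
    μ T = ∑ i ∈ Finset.univ.filter (fun i : Fin n => n - T.card ≤ (i : ℕ)), w i := by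
  rcases T.eq_empty_or_nonempty with rfl | hT
  · rw [h0, Finset.filter_false_of_mem (by simp), Finset.sum_empty]
  · exact hw T hT

/-- for a symmetric capacity with weight vector `w`, `|A| ≥ k` and
`S ⊆ A` with `|S| = k`,
`Σ_{B⊆S} (-1)^{|B|} μ(A∖B) = Σ_{j=0}^{k-1} (-1)^j C(k-1,j) w_{n-|A|+j+1}`. -/
theorem stmt_11 (n k : ℕ) (hk1 : 1 ≤ k) (hkn : k ≤ n) (μ : Finset (Fin n) → ℝ)
    (hμ : IsCapacity μ) (hs : IsSymmetricCap μ) (w : Fin n → ℝ) (hw : IsWeightOf w μ)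
    (A S : Finset (Fin n)) (hA : k ≤ A.card) (hS : S ⊆ A) (hSc : S.card = k) :
    ∑ B ∈ S.powerset, (-1 : ℝ) ^ B.card * μ (A \ B) =
      ∑ j ∈ Finset.range k, (-1 : ℝ) ^ j * ((k - 1).choose j : ℝ) * wAt w (n - A.card + j) := by
  obtain ⟨k, rfl⟩ := Nat.exists_eq_add_of_le' hk1
  have hAn : A.card ≤ n := by simpa using A.card_le_univ
  set F : ℕ → ℝ := fun i => ∑ x ∈ Finset.univ.filter (fun x : Fin n => i ≤ (x : ℕ)), w x
  have hμF : ∀ B ∈ S.powerset, (-1 : ℝ) ^ B.card * μ (A \ B) =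
      (-1 : ℝ) ^ B.card * F (n - A.card + B.card) := by
    intro B hB
    have hBA : B ⊆ A := (Finset.mem_powerset.1 hB).trans hS
    have hcard := Finset.card_le_card hBA
    rw [hw.eq_sum_filter hμ.1, Finset.card_sdiff_of_subset hBA,
      show n - (A.card - B.card) = n - A.card + B.card by omega]
  rw [Finset.sum_congr rfl hμF,
    Finset.sum_powerset_apply_card (fun m => (-1 : ℝ) ^ m * F (n - A.card + m)), hSc]
  calc ∑ m ∈ Finset.range (k + 1 + 1),
        (k + 1).choose m • ((-1 : ℝ) ^ m * F (n - A.card + m))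
      = ∑ m ∈ Finset.range (k + 2),
        (-1 : ℝ) ^ m * ((k + 1).choose m : ℝ) * F (n - A.card + m) := by
        refine Finset.sum_congr rfl fun m _ => ?_
        rw [nsmul_eq_mul]
        ring
    _ = _ := by
        rw [sum_range_choose_succ_alternating (fun m => F (n - A.card + m))]
        refine Finset.sum_congr rfl fun m hm => ?_
        have hm' := Finset.mem_range.1 hm
        have hstep : F (n - A.card + m) = wAt w (n - A.card + m) + F (n - A.card + (m + 1)) :=
          sum_filter_le_eq_wAt_add w (by omega)
        rw [Nat.add_sub_cancel, sub_eq_of_eq_add hstep]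
end

section
/- Let n ≥ 2 and let μ be a capacity on X = {1,…,n}. Then μ is at most 2-additive (its Möbius transform vanishes on every set of cardinality greater than 2) if and only if for every A ⊆ X and all distinct i, j ∈ A, μ(A) − μ(A∖{i}) − μ(A∖{j}) + μ(A∖{i,j}) = μ({i,j}) − μ({i}) − μ({j}). -/
open Finset

/-- The Möbius transform at `insert a S` is that of the first difference in direction `a`. -/
theorem mobius_insert {n : ℕ} (μ : Finset (Fin n) → ℝ) {a : Fin n} {S : Finset (Fin n)}
    (ha : a ∉ S) : mobius μ (insert a S) = mobius (fun B => μ (insert a B) - μ B) S := by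
  unfold mobius
  rw [sum_powerset_insert ha, ← sum_add_distrib]
  refine sum_congr rfl fun B hB => ?_
  rw [mem_powerset] at hB
  have hle := card_le_card hB
  rw [card_insert_of_notMem ha, card_insert_of_notMem fun h => ha (hB h),
    Nat.add_sub_add_right, Nat.sub_add_comm hle, pow_succ]
  ring

theorem mobius_empty {n : ℕ} (μ : Finset (Fin n) → ℝ) : mobius μ ∅ = μ ∅ := by
  simp [mobius]

theorem mobius_eq_zero_of_eq_const {n : ℕ} {g : Finset (Fin n) → ℝ} {c : ℝ}
    {S : Finset (Fin n)} (hS : S.Nonempty) (hg : ∀ B ⊆ S, g B = c) : mobius g S = 0 := by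
  obtain ⟨a, ha⟩ := hS
  rw [← insert_erase ha, mobius_insert g (notMem_erase a S)]
  refine sum_eq_zero fun B hB => ?_
  have hBS : B ⊆ S := (mem_powerset.1 hB).trans (erase_subset a S)
  simp [hg B hBS, hg _ (insert_subset ha hBS)]

theorem eq_apply_empty_of_mobius_eq_zero {n : ℕ} {g : Finset (Fin n) → ℝ}
    {T : Finset (Fin n)} (h : ∀ S ⊆ T, S.Nonempty → mobius g S = 0) : g T = g ∅ := by
  induction T using Finset.induction_on generalizing g with
  | empty => rfl
  | insert a T ha ih =>
    have hT := ih fun S hS => h S (hS.trans (subset_insert a T))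
    have hdiff : ∀ S ⊆ T, mobius (fun B => g (insert a B) - g B) S = 0 := fun S hS => by
      rw [← mobius_insert g fun haS => ha (hS haS)]
      exact h _ (insert_subset_insert a hS) (insert_nonempty a S)
    have h₁ := ih fun S hS _ => hdiff S hS
    have h₂ := hdiff ∅ (empty_subset T)
    rw [mobius_empty] at h₂
    linarith

theorem mobius_insert_insert {n : ℕ} (μ : Finset (Fin n) → ℝ) {i j : Fin n}
    {S : Finset (Fin n)} (hij : i ≠ j) (hi : i ∉ S) (hj : j ∉ S) :
    mobius μ (insert i (insert j S)) =
      mobius (fun B => μ (insert i (insert j B)) - μ (insert j B) - μ (insert i B) + μ B) S := by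
  rw [mobius_insert μ (by simp [hij, hi]), mobius_insert _ hj]
  congr 1
  funext B
  ring

/-- a capacity is at most 2-additive iff
`μ(A) - μ(A∖i) - μ(A∖j) + μ(A∖{i,j}) = μ({i,j}) - μ({i}) - μ({j})` for all `A` and
distinct `i, j ∈ A`. -/
theorem stmt_15 (n : ℕ) (hn : 2 ≤ n) (μ : Finset (Fin n) → ℝ) (hμ : IsCapacity μ) :
    AtMostAdditive 2 μ ↔
    (∀ A : Finset (Fin n), ∀ i ∈ A, ∀ j ∈ A, i ≠ j →
      μ A - μ (A.erase i) - μ (A.erase j) + μ ((A.erase i).erase j) =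
        μ {i, j} - μ {i} - μ {j}) := by
  constructor
  · intro h A i hi j hj hij
    have hj' : j ∈ A.erase i := mem_erase.2 ⟨hij.symm, hj⟩
    have key := eq_apply_empty_of_mobius_eq_zero
      (g := fun B => μ (insert i (insert j B)) - μ (insert j B) - μ (insert i B) + μ B)
      (T := (A.erase i).erase j) fun S hS hne => by
        have hiS : i ∉ S := fun h => by simpa using hS h
        have hjS : j ∉ S := fun h => by simpa using hS h
        rw [← mobius_insert_insert μ hij hiS hjS]
        apply h
        rw [card_insert_of_notMem (by simp [hij, hiS]), card_insert_of_notMem hjS]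
        have := hne.card_pos
        omega
    have hiA : insert i ((A.erase i).erase j) = A.erase j := by
      rw [erase_right_comm, insert_erase (mem_erase.2 ⟨hij, hi⟩)]
    simp only [insert_erase hj', insert_erase hi, hiA, insert_empty_eq, hμ.1] at key
    linarith
  · intro h A hA
    obtain ⟨i, hi, j, hj, hij⟩ := one_lt_card.1 (show 1 < A.card by omega)
    have hj' : j ∈ A.erase i := mem_erase.2 ⟨hij.symm, hj⟩
    have hne : ((A.erase i).erase j).Nonempty := by
      rw [← card_pos, card_erase_of_mem hj', card_erase_of_mem hi]
      omega
    rw [← insert_erase hi, ← insert_erase hj',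
      mobius_insert_insert μ hij (by simp) (by simp)]
    refine mobius_eq_zero_of_eq_const (c := μ {i, j} - μ {i} - μ {j}) hne fun B hB => ?_
    have hiB : i ∉ B := fun h => by simpa using hB h
    have hjB : j ∉ B := fun h => by simpa using hB h
    have key := h (insert i (insert j B)) i (by simp) j (by simp) hij
    have hiI : i ∉ insert j B := by simp [hij, hiB]
    rw [erase_insert hiI, erase_insert hjB, erase_insert_of_ne hij, erase_insert hjB] at key
    linarith
end

section
/- Let 1 ≤ k ≤ n and let μ be a capacity on X = {1,…,n}. Then μ is at most k-additive (its Möbius transform vanishes on every set of cardinality greater than k) if and only if for every subset {i_1,…,i_k} ⊆ X of cardinality k and every A ⊆ X with {i_1,…,i_k} ⊆ A, Σ_{B⊆{i_1,…,i_k}} (−1)^{|B|} μ(A∖B) = Σ_{B⊆{i_1,…,i_k}} (−1)^{|B|} μ({i_1,…,i_k}∖B). -/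
open Finset

/-- The signed sum `Σ_{B ⊆ S} (-1)^|B| μ(A ∖ B)`. -/
def signedDiff {α : Type*} [DecidableEq α] (μ : Finset α → ℝ) (S A : Finset α) : ℝ :=
  ∑ B ∈ S.powerset, (-1 : ℝ) ^ B.card * μ (A \ B)

section signedDiff

variable {α : Type*} [DecidableEq α] {μ : Finset α → ℝ}

theorem signedDiff_insert {i : α} {S : Finset α} (hi : i ∉ S) (A : Finset α) :
    signedDiff μ (insert i S) A = signedDiff μ S A - signedDiff μ S (A.erase i) := by
  unfold signedDiff
  rw [Finset.sum_powerset_insert hi, sub_eq_add_neg, ← Finset.sum_neg_distrib]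
  congr 1
  refine Finset.sum_congr rfl fun B hB => ?_
  have hiB : i ∉ B := fun h => hi (Finset.mem_powerset.1 hB h)
  rw [Finset.card_insert_of_notMem hiB, Finset.sdiff_insert, Finset.erase_sdiff_comm]
  ring

theorem signedDiff_eq_zero_of_subset {S T A : Finset α}
    (h : ∀ A, S ⊆ A → signedDiff μ S A = signedDiff μ S S) (hST : S ⊂ T) (hTA : T ⊆ A) :
    signedDiff μ T A = 0 := by
  induction T using Finset.strongInduction generalizing A with
  | H T ih =>
    obtain ⟨i, hiT, hiS⟩ := Finset.exists_of_ssubset hST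
    have hS : S ⊆ T.erase i := Finset.subset_erase.2 ⟨hST.subset, hiS⟩
    have hTA' : T.erase i ⊆ A.erase i := Finset.erase_subset_erase i hTA
    have hTA'' : T.erase i ⊆ A := (Finset.erase_subset i T).trans hTA
    rw [← Finset.insert_erase hiT, signedDiff_insert (Finset.notMem_erase i T)]
    rcases hS.eq_or_ssubset with hEq | hlt
    · rw [← hEq] at hTA' hTA'' ⊢
      rw [h _ hTA', h _ hTA'', sub_self]
    · have hlt' := Finset.erase_ssubset hiT
      rw [ih _ hlt' hlt hTA', ih _ hlt' hlt hTA'', sub_self]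

theorem signedDiff_eq_self_of_insert {S A : Finset α} (hSA : S ⊆ A)
    (h : ∀ i A', i ∉ S → insert i S ⊆ A' → A' ⊆ A → signedDiff μ (insert i S) A' = 0) :
    signedDiff μ S A = signedDiff μ S S := by
  induction A using Finset.strongInduction with
  | H A ih =>
    rcases hSA.eq_or_ssubset with rfl | hlt
    · rfl
    · obtain ⟨i, hiA, hiS⟩ := Finset.exists_of_ssubset hlt
      have hz := h i A hiS (Finset.insert_subset hiA hSA) subset_rfl
      rw [signedDiff_insert hiS, sub_eq_zero] at hz
      rw [hz]
      exact ih _ (Finset.erase_ssubset hiA) (Finset.subset_erase.2 ⟨hSA, hiS⟩)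
        fun j A' hj hjA' hA' => h j A' hj hjA' (hA'.trans (Finset.erase_subset i A))

theorem signedDiff_eq_zero_of_self {k : ℕ}
    (h : ∀ A : Finset α, k < A.card → signedDiff μ A A = 0) {S A : Finset α}
    (hS : k < S.card) (hSA : S ⊆ A) : signedDiff μ S A = 0 := by
  induction hd : A.card - S.card using Nat.strong_induction_on generalizing S A with
  | _ d ih =>
    rw [signedDiff_eq_self_of_insert hSA, h S hS]
    intro i A' hi hA' hAA'
    have h₁ := Finset.card_insert_of_notMem hi
    have h₂ := Finset.card_le_card hA'
    have h₃ := Finset.card_le_card hAA'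
    exact ih _ (by omega) (by omega) hA' rfl

end signedDiff

theorem mobius_eq_signedDiff {n : ℕ} (μ : Finset (Fin n) → ℝ) (A : Finset (Fin n)) :
    mobius μ A = signedDiff μ A A := by
  refine Finset.sum_nbij' (A \ ·) (A \ ·) ?_ ?_ ?_ ?_ ?_
  · simp
  · simp
  · exact fun B hB => Finset.sdiff_sdiff_eq_self (Finset.mem_powerset.1 hB)
  · exact fun B hB => Finset.sdiff_sdiff_eq_self (Finset.mem_powerset.1 hB)
  · intro B hB
    have hBA := Finset.mem_powerset.1 hB
    rw [Finset.sdiff_sdiff_eq_self hBA, Finset.card_sdiff_of_subset hBA]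

/-- a capacity is at most k-additive iff for every `S` of cardinality `k` and
every `A ⊇ S`, `Σ_{B⊆S} (-1)^{|B|} μ(A∖B) = Σ_{B⊆S} (-1)^{|B|} μ(S∖B)`. -/
theorem stmt_18 (n k : ℕ) (hk1 : 1 ≤ k) (hkn : k ≤ n) (μ : Finset (Fin n) → ℝ)
    (hμ : IsCapacity μ) :
    AtMostAdditive k μ ↔
    (∀ S : Finset (Fin n), S.card = k → ∀ A : Finset (Fin n), S ⊆ A →
      ∑ B ∈ S.powerset, (-1 : ℝ) ^ B.card * μ (A \ B) =
        ∑ B ∈ S.powerset, (-1 : ℝ) ^ B.card * μ (S \ B)) := by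
  constructor
  · intro h S hS A hSA
    refine signedDiff_eq_self_of_insert hSA fun i A' hi hA' _ => ?_
    exact signedDiff_eq_zero_of_self (fun A hA => mobius_eq_signedDiff μ A ▸ h A hA)
      (by rw [Finset.card_insert_of_notMem hi]; omega) hA'
  · intro h A hA
    obtain ⟨S, hSA, hS⟩ := Finset.exists_subset_card_eq hA.le
    rw [mobius_eq_signedDiff]
    refine signedDiff_eq_zero_of_subset (h S hS) (hSA.ssubset_of_ne ?_) subset_rfl
    rintro rfl
    omega
end
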